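/- arXiv:1404.0525 — 4 statements merged into one kernel-verified Lean document; each statement's English description precedes it below -/
import Mathlib

section
/- Let Q be a real symmetric positive definite 3×3 matrix and let E be the ellipsoid {x ∈ ℝ³ : (x − c)ᵀ Q⁻¹ (x − c) ≤ 1} with centre c, so that the eigenvalues of Q are the squared lengths of the semiaxes of E. Let B be the sphere of radius R > 0 centred at the origin, and suppose E is contained in the closed ball bounded by B. Set d = |c| and, when d ≠ 0, let d̂ = c/d be the unit vector along c. Define u = R² − tr Q + 2 d̂ᵀ Q d̂ and q = R⁴ − 2R² tr Q − 8R √(det Q) + 2 tr(Q²) − (tr Q)². Then there exists a tetrahedron (the convex hull of four points each lying on the sphere B) containing E if and only if d⁴ − 2u d² + q ≥ 0. (When d = 0 the term 2 d̂ᵀ Q d̂ in u is taken to be 0, which is consistent since it is multiplied by d² in the inequality.) -/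
open Matrix

/-- A symmetric antilinear map has an orthonormal basis of eigenvectors with nonnegative
eigenvalues. -/
theorem exists_orthonormal_antilinear_eigenvectors (n : ℕ) :
    ∀ (E : Type) [NormedAddCommGroup E] [InnerProductSpace ℂ E] [FiniteDimensional ℂ E]
      (A : E →ₗ⋆[ℂ] E) (_ : ∀ x y, inner ℂ (A x) y = inner ℂ (A y) x)
      (_ : Module.finrank ℂ E = n),
    ∃ (v : Fin n → E) (l : Fin n → ℝ), Orthonormal ℂ v ∧ (∀ i, 0 ≤ l i) ∧
      ∀ i, A (v i) = (l i : ℂ) • v i := by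
  induction n with
  | zero =>
    intro E _ _ _ A hA hn
    exact ⟨Fin.elim0, Fin.elim0, ⟨fun i => i.elim0, fun i => i.elim0⟩, fun i => i.elim0,
      fun i => i.elim0⟩
  | succ n ih =>
    intro E _ _ _ A hA hn
    have hnt : Nontrivial E := Module.nontrivial_of_finrank_pos (R := ℂ) (by omega)
    -- a unit eigenvector
    obtain ⟨v, l, hv, hl, hAv⟩ : ∃ (v : E) (l : ℝ), v ≠ 0 ∧ 0 ≤ l ∧ A v = (l : ℂ) • v := by
      obtain ⟨μ, hμ⟩ := Module.End.exists_eigenvalue (K := ℂ) (A.comp A : E →ₗ[ℂ] E)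
      obtain ⟨x, hx⟩ := hμ.exists_hasEigenvector
      have hx0 : x ≠ 0 := hx.2
      have hxe : A (A x) = μ • x := by simpa using hx.apply_eq_smul
      have hμ' : μ = ((‖A x‖ / ‖x‖ : ℝ) : ℂ) ^ 2 := by
        have h1 := hA (A x) x
        rw [hxe, inner_smul_left, inner_self_eq_norm_sq_to_K, inner_self_eq_norm_sq_to_K] at h1
        have h2 : (‖x‖ : ℂ) ≠ 0 := by simpa using hx0
        have h3 : (starRingEnd ℂ) μ = ((‖A x‖ / ‖x‖ : ℝ) : ℂ) ^ 2 := by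
          push_cast
          rw [div_pow, eq_div_iff (pow_ne_zero 2 h2)]
          exact h1
        have h4 := congrArg (starRingEnd ℂ) h3
        rw [Complex.conj_conj, map_pow, Complex.conj_ofReal] at h4
        exact h4
      set l : ℝ := ‖A x‖ / ‖x‖ with hl
      have hl0 : 0 ≤ l := by positivity
      by_cases hy : A x + (l : ℂ) • x = 0
      · refine ⟨Complex.I • x, l, smul_ne_zero Complex.I_ne_zero hx0, hl0, ?_⟩
        rw [LinearMap.map_smulₛₗ, eq_neg_of_add_eq_zero_left hy, Complex.conj_I, smul_neg, neg_smul,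
          neg_neg, smul_comm]
      · refine ⟨_, l, hy, hl0, ?_⟩
        rw [map_add, hxe, LinearMap.map_smulₛₗ, Complex.conj_ofReal, hμ', smul_add, smul_smul,
          add_comm, pow_two]
    set e : E := ((‖v‖⁻¹ : ℝ) : ℂ) • v with he
    have hvn : ‖v‖ ≠ 0 := by simpa using hv
    have hen : ‖e‖ = 1 := by
      rw [he, norm_smul, Complex.norm_real, norm_inv, norm_norm, inv_mul_cancel₀ hvn]
    have hAe : A e = (l : ℂ) • e := by
      rw [he, LinearMap.map_smulₛₗ, Complex.conj_ofReal, hAv, smul_comm]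
    let W : Submodule ℂ E := (ℂ ∙ e)ᗮ
    have hW : ∀ w : W, A w ∈ W := by
      intro w
      have := w.2
      rw [Submodule.mem_orthogonal_singleton_iff_inner_left] at this ⊢
      rw [hA, hAe, inner_smul_left, inner_eq_zero_symm.1 this, mul_zero]
    have hWn : Module.finrank ℂ W = n := by
      have : Fact (Module.finrank ℂ E = n + 1) := ⟨hn⟩
      exact Submodule.finrank_orthogonal_span_singleton (by rintro h; simp [h] at hen)
    obtain ⟨u, m, hu, hm, hAu⟩ := ih W (LinearMap.codRestrict W (A.comp W.subtype) hW)
      (fun x y => hA x y) hWn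
    refine ⟨Fin.cons e (fun i => (u i : E)), Fin.cons l m, ?_, ?_, ?_⟩
    · have hu' : ∀ i j, inner ℂ (u i : E) (u j : E) = if i = j then 1 else 0 := by
        intro i j
        simpa using (orthonormal_iff_ite.1 hu) i j
      have hue : ∀ i, inner ℂ (u i : E) e = 0 := fun i =>
        (Submodule.mem_orthogonal_singleton_iff_inner_left.1 (u i).2)
      rw [orthonormal_iff_ite]
      intro i j
      refine Fin.cases ?_ (fun i => ?_) i <;> refine Fin.cases ?_ (fun j => ?_) j
      · simp [inner_self_eq_norm_sq_to_K, hen]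
      · simp [inner_eq_zero_symm.1 (hue j), (Fin.succ_ne_zero j).symm]
      · simp [hue i]
      · simp [hu']
    · intro i
      refine Fin.cases ?_ (fun i => ?_) i
      · exact hl
      · exact hm i
    · intro i
      refine Fin.cases ?_ (fun i => ?_) i
      · exact hAe
      · exact congrArg Subtype.val (hAu i)

/-- Takagi factorization of a complex symmetric matrix. -/
theorem exists_takagi_factorization {n : ℕ} (S : Matrix (Fin n) (Fin n) ℂ) (hS : Sᵀ = S) :
    ∃ (U : Matrix (Fin n) (Fin n) ℂ) (l : Fin n → ℝ), U * Uᴴ = 1 ∧ (∀ i, 0 ≤ l i) ∧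
      Uᵀ * S * U = diagonal (fun i => (l i : ℂ)) := by
  let A : EuclideanSpace ℂ (Fin n) →ₗ⋆[ℂ] EuclideanSpace ℂ (Fin n) :=
    { toFun := fun x => WithLp.toLp 2 (star (S *ᵥ x.ofLp))
      map_add' := fun x y => by simp [mulVec_add]
      map_smul' := fun a x => by ext i; simp [mulVec_smul] }
  have hA : ∀ x y, inner ℂ (A x) y = inner ℂ (A y) x := by
    intro x y
    have h : ∀ x y : EuclideanSpace ℂ (Fin n), inner ℂ (A x) y = y.ofLp ⬝ᵥ S *ᵥ x.ofLp := by
      intro x y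
      simp [A, EuclideanSpace.inner_eq_star_dotProduct]
    rw [h, h, dotProduct_mulVec, ← mulVec_transpose, hS, dotProduct_comm]
  obtain ⟨v, l, hv, hl, hAv⟩ :=
    exists_orthonormal_antilinear_eigenvectors n _ A hA (by simp)
  rw [orthonormal_iff_ite] at hv
  refine ⟨Matrix.of fun i j => v j i, l, ?_, hl, ?_⟩
  · rw [mul_eq_one_comm]
    ext i j
    have := hv i j
    rw [EuclideanSpace.inner_eq_star_dotProduct] at this
    rw [one_apply, ← this, dotProduct_comm]
    rfl
  · ext i j
    have h2 : S *ᵥ (v j).ofLp = star ((l j : ℂ) • (v j).ofLp) := by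
      have := congrArg (fun w => star (WithLp.ofLp w)) (hAv j)
      simpa [A] using this
    have h3 : ((Matrix.of fun i j => v j i)ᵀ * S * (Matrix.of fun i j => v j i)) i j
        = (v i).ofLp ⬝ᵥ S *ᵥ (v j).ofLp := by
      rw [Matrix.mul_assoc]
      rfl
    have h4 := hv j i
    rw [EuclideanSpace.inner_eq_star_dotProduct] at h4
    rw [h3, h2, star_smul, dotProduct_smul, h4, diagonal_apply]
    by_cases hij : i = j
    · subst hij; simp
    · simp [hij, Ne.symm hij]

theorem exists_unit_complex_triangle {a b r : ℝ} (h1 : |a - b| ≤ r) (h2 : r ≤ a + b) :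
    ∃ z w : ℂ, ‖z‖ = 1 ∧ ‖w‖ = 1 ∧ a * z + b * w = r := by
  have hf : Continuous fun θ : ℝ => ‖(a : ℂ) + b * Complex.exp (θ * Complex.I)‖ := by fun_prop
  have hr : r ∈ (fun θ : ℝ => ‖(a : ℂ) + b * Complex.exp (θ * Complex.I)‖) ''
      Set.Icc 0 Real.pi := by
    apply intermediate_value_Icc' Real.pi_pos.le hf.continuousOn
    constructor
    · simp only [Complex.exp_pi_mul_I, mul_neg, mul_one, ← sub_eq_add_neg, ← Complex.ofReal_sub,
        Complex.norm_real]
      exact h1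
    · simp only [Complex.ofReal_zero, zero_mul, Complex.exp_zero, mul_one, ← Complex.ofReal_add,
        Complex.norm_real]
      exact h2.trans (le_abs_self _)
  obtain ⟨θ, -, hθ⟩ := hr
  simp only at hθ
  set s : ℂ := (a : ℂ) + b * Complex.exp (θ * Complex.I) with hs
  have hs' := Complex.norm_mul_exp_arg_mul_I s
  rw [hθ] at hs'
  have hE : Complex.exp (s.arg * Complex.I) * Complex.exp ((-s.arg : ℝ) * Complex.I) = 1 := by
    rw [← Complex.exp_add]; simp
  refine ⟨Complex.exp ((-s.arg : ℝ) * Complex.I),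
    Complex.exp (θ * Complex.I) * Complex.exp ((-s.arg : ℝ) * Complex.I),
    Complex.norm_exp_ofReal_mul_I _, ?_, ?_⟩
  · rw [norm_mul, Complex.norm_exp_ofReal_mul_I, Complex.norm_exp_ofReal_mul_I, one_mul]
  · linear_combination (-Complex.exp ((-s.arg : ℝ) * Complex.I)) * hs' + (r : ℂ) * hE
      - Complex.exp ((-s.arg : ℝ) * Complex.I) * hs

/-- Nonnegative reals satisfying the (Brahmagupta type) quadrilateral inequality are the side
lengths of a closed planar quadrilateral. -/
theorem exists_closed_quadrilateral (l : Fin 4 → ℝ) (hl : ∀ i, 0 ≤ l i)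
    (h : 0 ≤ (∑ i, l i ^ 2) ^ 2 - 2 * ∑ i, l i ^ 4 + 8 * ∏ i, l i) :
    ∃ z : Fin 4 → ℂ, (∀ i, ‖z i‖ = 1) ∧ ∑ i, z i ^ 2 * (l i : ℂ) = 0 := by
  have key : ∀ a b c d : ℝ, 0 ≤ a → 0 ≤ b → 0 ≤ c → 0 ≤ d →
      0 ≤ (b + c + d - a) * (a + c + d - b) * (a + b + d - c) * (a + b + c - d) →
      a ≤ b + c + d := by
    intro a b c d ha hb hc hd hp
    by_contra! hlt
    have h1 : 0 < (a + c + d - b) * (a + b + d - c) * (a + b + c - d) :=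
      mul_pos (mul_pos (by linarith) (by linarith)) (by linarith)
    nlinarith
  simp only [Fin.sum_univ_four, Fin.prod_univ_four] at h ⊢
  have h0 := hl 0
  have h1 := hl 1
  have h2 := hl 2
  have h3 := hl 3
  have k0 := key (l 0) (l 1) (l 2) (l 3) h0 h1 h2 h3 (by nlinarith)
  have k1 := key (l 1) (l 0) (l 2) (l 3) h1 h0 h2 h3 (by nlinarith)
  have k2 := key (l 2) (l 0) (l 1) (l 3) h2 h0 h1 h3 (by nlinarith)
  have k3 := key (l 3) (l 0) (l 1) (l 2) h3 h0 h1 h2 (by nlinarith)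
  obtain ⟨z0, z1, hz0, hz1, hz⟩ := exists_unit_complex_triangle (a := l 0) (b := l 1)
    (r := max |l 0 - l 1| |l 2 - l 3|) (le_max_left _ _)
    (max_le (abs_le.2 ⟨by linarith, by linarith⟩) (abs_le.2 ⟨by linarith, by linarith⟩))
  obtain ⟨z2, z3, hz2, hz3, hz'⟩ := exists_unit_complex_triangle (a := l 2) (b := l 3)
    (r := max |l 0 - l 1| |l 2 - l 3|) (le_max_right _ _)
    (max_le (abs_le.2 ⟨by linarith, by linarith⟩) (abs_le.2 ⟨by linarith, by linarith⟩))
  have hsq : ∀ z : ℂ, ‖z‖ = 1 → ∃ w : ℂ, ‖w‖ = 1 ∧ w ^ 2 = z := by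
    intro z hz
    obtain ⟨w, hw⟩ := IsAlgClosed.exists_pow_nat_eq z (n := 2) two_pos
    refine ⟨w, ?_, hw⟩
    rw [← hw, norm_pow] at hz
    exact (pow_eq_one_iff_of_nonneg (norm_nonneg _) two_ne_zero).1 hz
  obtain ⟨w0, hw0, e0⟩ := hsq z0 hz0
  obtain ⟨w1, hw1, e1⟩ := hsq z1 hz1
  obtain ⟨w2, hw2, e2⟩ := hsq (-z2) (by rwa [norm_neg])
  obtain ⟨w3, hw3, e3⟩ := hsq (-z3) (by rwa [norm_neg])
  refine ⟨![w0, w1, w2, w3], ?_, ?_⟩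
  · intro i; fin_cases i <;> assumption
  · simp only [cons_val_zero, cons_val_one, cons_val]
    rw [e0, e1, e2, e3]
    linear_combination hz - hz'

open scoped ComplexOrder in
theorem Matrix.PosSemidef.exists_eq_mul_conjTranspose {n : ℕ} {H : Matrix (Fin n) (Fin n) ℂ}
    (hH : H.PosSemidef) : ∃ V : Matrix (Fin n) (Fin n) ℂ, H = V * Vᴴ := by
  refine ⟨(hH.1.eigenvectorUnitary : Matrix (Fin n) (Fin n) ℂ) *
    diagonal (fun i => (Real.sqrt (hH.1.eigenvalues i) : ℂ)), ?_⟩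
  conv_lhs => rw [hH.1.spectral_theorem, Unitary.conjStarAlgAut_apply]
  rw [conjTranspose_mul, diagonal_conjTranspose, Matrix.mul_assoc, Matrix.mul_assoc,
    ← Matrix.mul_assoc (diagonal _) (diagonal _), diagonal_mul_diagonal, star_eq_conjTranspose]
  congr 3
  funext i
  simp [← Complex.ofReal_mul, Real.mul_self_sqrt (hH.eigenvalues_nonneg i)]

open scoped ComplexOrder in
/-- Decomposition of a positive semidefinite `4 × 4` matrix into four rank one matrices
`w wᴴ` with `w` isotropic for the bilinear form `Y`. -/
theorem exists_isotropic_decomposition {H Y : Matrix (Fin 4) (Fin 4) ℂ} (hH : H.PosSemidef)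
    (hYt : Yᵀ = Y) (hYc : Yᴴ = Y) (hYd : Y.det = 1) {a b : ℝ}
    (ha : (H * Y * Hᵀ * Y).trace = a)
    (hb : ((H * Y * Hᵀ * Y) * (H * Y * Hᵀ * Y)).trace = b)
    (hpos : 0 ≤ a ^ 2 - 2 * b + 8 * (H.det).re) :
    ∃ W : Matrix (Fin 4) (Fin 4) ℂ, H = W * Wᴴ ∧ ∀ k, (Wᵀ * Y * W) k k = 0 := by
  obtain ⟨V, hV⟩ := hH.exists_eq_mul_conjTranspose
  obtain ⟨U, l, hU, hl, hUV⟩ := exists_takagi_factorization (Vᵀ * Y * V)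
    (by rw [transpose_mul, transpose_mul, hYt, transpose_transpose, Matrix.mul_assoc])
  set W := V * U with hW
  set L : Matrix (Fin 4) (Fin 4) ℂ := diagonal (fun i => (l i : ℂ)) with hL
  have hHW : H = W * Wᴴ := by
    rw [hV, hW, conjTranspose_mul, Matrix.mul_assoc, ← Matrix.mul_assoc U, hU, Matrix.one_mul]
  have hWL : Wᵀ * Y * W = L := by
    rw [← hUV, hW, transpose_mul]
    simp only [Matrix.mul_assoc]
  have hWL' : Wᴴ * Y * Wᵀᴴ = L := by
    have : (Wᵀ * Y * W)ᴴ = Lᴴ := by rw [hWL]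
    rw [conjTranspose_mul (Wᵀ * Y), conjTranspose_mul Wᵀ, hYc, ← Matrix.mul_assoc] at this
    rw [this, hL, diagonal_conjTranspose]
    congr 1
    ext i
    simp
  have hHt : Hᵀ = Wᵀᴴ * Wᵀ := by
    rw [hHW, transpose_mul]; rfl
  have hN : H * Y * Hᵀ * Y = W * (L * (Wᵀ * Y)) := by
    rw [hHt, ← hWL']
    conv_lhs => rw [hHW]
    simp only [Matrix.mul_assoc]
  have hN2 : (H * Y * Hᵀ * Y) * (H * Y * Hᵀ * Y) = W * (L * L * L * (Wᵀ * Y)) := by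
    have hXW : ∀ Z, Wᵀ * (Y * (W * Z)) = L * Z := by
      intro Z
      rw [← hWL]
      simp only [Matrix.mul_assoc]
    rw [hN]
    simp only [Matrix.mul_assoc, hXW]
  have ha' : a = ∑ i, l i ^ 2 := by
    have : (a : ℂ) = ∑ i, (l i : ℂ) ^ 2 := by
      rw [← ha, hN, trace_mul_comm, Matrix.mul_assoc, hWL, hL, diagonal_mul_diagonal,
        trace_diagonal]
      simp only [pow_two]
    exact_mod_cast this
  have hb' : b = ∑ i, l i ^ 4 := by
    have : (b : ℂ) = ∑ i, (l i : ℂ) ^ 4 := by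
      rw [← hb, hN2, trace_mul_comm, Matrix.mul_assoc, hWL, hL, diagonal_mul_diagonal,
        diagonal_mul_diagonal, diagonal_mul_diagonal, trace_diagonal]
      refine Finset.sum_congr rfl fun i _ => by ring
    exact_mod_cast this
  have hdet : (H.det).re = ∏ i, l i := by
    have h1 : W.det ^ 2 = ((∏ i, l i : ℝ) : ℂ) := by
      have := congrArg det hWL
      rw [det_mul, det_mul, det_transpose, hYd, hL, det_diagonal] at this
      push_cast
      rw [← this]; ring
    have h2 : H.det = ((‖W.det‖ ^ 2 : ℝ) : ℂ) := by
      rw [hHW, det_mul, det_conjTranspose]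
      push_cast
      exact Complex.mul_conj' _
    rw [h2, Complex.ofReal_re, ← norm_pow, h1, Complex.norm_real, Real.norm_eq_abs,
      abs_of_nonneg (Finset.prod_nonneg fun i _ => hl i)]
  rw [ha', hb', hdet] at hpos
  obtain ⟨z, hz, hz0⟩ := exists_closed_quadrilateral l hl hpos
  let M : Matrix (Fin 4) (Fin 4) ℂ :=
    !![1/2, 1/2, 1/2, 1/2; 1/2, 1/2, -1/2, -1/2; 1/2, -1/2, 1/2, -1/2; 1/2, -1/2, -1/2, 1/2]
  have hMH : Mᴴ = M := by
    ext i j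
    fin_cases i <;> fin_cases j <;> simp [M]
  have hM : M * Mᴴ = 1 := by
    rw [hMH]
    ext i j
    fin_cases i <;> fin_cases j <;>
      simp [M, Matrix.mul_apply, Fin.sum_univ_four, one_apply] <;> norm_num
  have hMsq : ∀ i j, M i j * M i j = 1 / 4 := by
    intro i j
    fin_cases i <;> fin_cases j <;> norm_num [M]
  have hZ : diagonal z * (diagonal z)ᴴ = 1 := by
    rw [diagonal_conjTranspose, diagonal_mul_diagonal, ← diagonal_one]
    congr 1
    ext i
    have := Complex.mul_conj' (z i)
    rw [hz i] at this
    simpa using this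
  refine ⟨W * (diagonal z * M), ?_, ?_⟩
  · have h1 : diagonal z * M * (diagonal z * M)ᴴ = 1 := by
      rw [conjTranspose_mul, Matrix.mul_assoc, ← Matrix.mul_assoc M, hM, Matrix.one_mul, hZ]
    rw [conjTranspose_mul W, Matrix.mul_assoc W, ← Matrix.mul_assoc (diagonal z * M), h1,
      Matrix.one_mul, hHW]
  · intro k
    have : (W * (diagonal z * M))ᵀ * Y * (W * (diagonal z * M))
        = Mᵀ * (diagonal z * L * diagonal z) * M := by
      rw [← hWL, transpose_mul, transpose_mul, diagonal_transpose]
      simp only [Matrix.mul_assoc]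
    rw [this, hL, diagonal_mul_diagonal, diagonal_mul_diagonal, Matrix.mul_apply]
    simp only [mul_diagonal, transpose_apply]
    calc ∑ j, M j k * (z j * (l j : ℂ) * z j) * M j k
        = ∑ j, (1 / 4) * (z j ^ 2 * (l j : ℂ)) :=
          Finset.sum_congr rfl fun j _ => by rw [← hMsq j k]; ring
      _ = 0 := by rw [← Finset.mul_sum, hz0, mul_zero]

/-- The Hermitian matrix `R + ∑ cᵢ σᵢ ⊗ 1 + ∑ sᵢ σᵢ ⊗ σᵢ` in Pauli matrices `σᵢ`. -/
noncomputable def pauliMatrix (R : ℝ) (c s : Fin 3 → ℝ) : Matrix (Fin 4) (Fin 4) ℂ :=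
  !![R + c 2 + s 2, 0, c 0 - c 1 * Complex.I, s 0 - s 1;
    0, R + c 2 - s 2, s 0 + s 1, c 0 - c 1 * Complex.I;
    c 0 + c 1 * Complex.I, s 0 + s 1, R - c 2 - s 2, 0;
    s 0 - s 1, c 0 + c 1 * Complex.I, 0, R - c 2 + s 2]

/-- The matrix `-σ₂ ⊗ σ₂`, the polarization of the determinant of `2 × 2` matrices. -/
def detForm : Matrix (Fin 4) (Fin 4) ℂ :=
  !![0, 0, 0, 1; 0, 0, -1, 0; 0, -1, 0, 0; 1, 0, 0, 0]

/-- The nested tetrahedron polynomial for centre `c` and semiaxes `s` along the coordinate axes. -/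
def nestedPoly (R : ℝ) (c s : Fin 3 → ℝ) : ℝ :=
  (∑ i, c i ^ 2) ^ 2 - 2 * ((R ^ 2 - ∑ i, s i ^ 2) * ∑ i, c i ^ 2 + 2 * ∑ i, s i ^ 2 * c i ^ 2)
    + (R ^ 4 - 2 * R ^ 2 * ∑ i, s i ^ 2 - 8 * R * ∏ i, s i + 2 * ∑ i, s i ^ 4
      - (∑ i, s i ^ 2) ^ 2)

theorem pauliMatrix_isHermitian (R : ℝ) (c s : Fin 3 → ℝ) : (pauliMatrix R c s).IsHermitian := by
  ext i j
  fin_cases i <;> fin_cases j <;> simp [pauliMatrix, ← sub_eq_add_neg]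

theorem detForm_transpose : detFormᵀ = detForm := by
  ext i j
  fin_cases i <;> fin_cases j <;> simp [detForm]

theorem detForm_conjTranspose : detFormᴴ = detForm := by
  ext i j
  fin_cases i <;> fin_cases j <;> simp [detForm]

theorem det_detForm : detForm.det = 1 := by
  simp [detForm, det_succ_row_zero, Fin.sum_univ_succ, Fin.succAbove]
  norm_num

theorem det_pauliMatrix (R : ℝ) (c s : Fin 3 → ℝ) :
    (pauliMatrix R c s).det = (nestedPoly R c s : ℂ) := by
  simp [pauliMatrix, nestedPoly, det_succ_row_zero, Fin.sum_univ_succ, Fin.prod_univ_succ,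
    Fin.succAbove]
  ring_nf
  simp only [Complex.I_sq, Complex.I_pow_four]
  ring

theorem pauliMatrix_spinFlip (R : ℝ) (c s : Fin 3 → ℝ) :
    pauliMatrix R c s * detForm * (pauliMatrix R c s)ᵀ * detForm =
      pauliMatrix R c s * pauliMatrix R (-c) s := by
  rw [Matrix.mul_assoc, Matrix.mul_assoc]
  congr 1
  ext i j
  fin_cases i <;> fin_cases j <;>
    simp [pauliMatrix, detForm, Matrix.mul_apply, Fin.sum_univ_four] <;> ring

theorem trace_pauliMatrix_mul (R : ℝ) (c s : Fin 3 → ℝ) :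
    (pauliMatrix R c s * pauliMatrix R (-c) s).trace =
      ((4 * (R ^ 2 - ∑ i, c i ^ 2 + ∑ i, s i ^ 2) : ℝ) : ℂ) := by
  simp [pauliMatrix, Matrix.trace, Fin.sum_univ_succ]
  ring_nf
  simp only [Complex.I_sq]
  ring

theorem trace_pauliMatrix_mul_sq (R : ℝ) (c s : Fin 3 → ℝ) :
    ((pauliMatrix R c s * pauliMatrix R (-c) s) * (pauliMatrix R c s * pauliMatrix R (-c) s)).trace
      = ((8 * (R ^ 2 - ∑ i, c i ^ 2 + ∑ i, s i ^ 2) ^ 2 + 4 * nestedPoly R c s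
        - 8 * nestedPoly R c (-s) : ℝ) : ℂ) := by
  simp [pauliMatrix, nestedPoly, Matrix.trace, Fin.sum_univ_succ,
    Fin.prod_univ_succ]
  ring_nf
  simp only [Complex.I_sq, Complex.I_pow_four]
  ring

/-- The tensor product of two vectors of `ℂ²`, in coordinates. -/
def tensorVec (x y : Fin 2 → ℂ) : Fin 4 → ℂ :=
  ![x 0 * y 0, x 0 * y 1, x 1 * y 0, x 1 * y 1]

theorem exists_eq_tensorVec {w : Fin 4 → ℂ} (hw : w 0 * w 3 = w 1 * w 2) :
    ∃ x y, w = tensorVec x y := by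
  by_cases h0 : w 0 = 0
  · rw [h0, zero_mul, eq_comm, mul_eq_zero] at hw
    rcases hw with h1 | h2
    · refine ⟨![0, 1], ![w 2, w 3], ?_⟩
      ext i
      fin_cases i <;> simp [tensorVec, h0, h1]
    · refine ⟨![w 1, w 3], ![0, 1], ?_⟩
      ext i
      fin_cases i <;> simp [tensorVec, h0, h2]
  · refine ⟨![1, w 2 / w 0], ![w 0, w 1], ?_⟩
    ext i
    fin_cases i <;> simp [tensorVec]
    · field_simp
    · field_simp
      linear_combination hw

/-- The squared norm of `x`. -/
noncomputable def blochNorm (x : Fin 2 → ℂ) : ℝ :=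
  (x 0).re ^ 2 + (x 0).im ^ 2 + (x 1).re ^ 2 + (x 1).im ^ 2

/-- The unnormalized Bloch vector `i ↦ xᴴ σᵢ x`. -/
noncomputable def blochVec (x : Fin 2 → ℂ) : Fin 3 → ℝ :=
  ![2 * ((x 0).re * (x 1).re + (x 0).im * (x 1).im),
    2 * ((x 0).re * (x 1).im - (x 0).im * (x 1).re),
    (x 0).re ^ 2 + (x 0).im ^ 2 - (x 1).re ^ 2 - (x 1).im ^ 2]

theorem blochNorm_nonneg (x : Fin 2 → ℂ) : 0 ≤ blochNorm x := by
  unfold blochNorm; positivity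

theorem sum_blochVec_sq (x : Fin 2 → ℂ) : ∑ i, blochVec x i ^ 2 = blochNorm x ^ 2 := by
  simp [Fin.sum_univ_three, blochVec, blochNorm]
  ring

theorem abs_sum_mul_blochVec_le {a : ℝ} {b : Fin 3 → ℝ} (ha : 0 ≤ a) (hb : ∑ i, b i ^ 2 ≤ a ^ 2)
    (x : Fin 2 → ℂ) : |∑ i, b i * blochVec x i| ≤ a * blochNorm x := by
  refine abs_le_of_sq_le_sq ?_ (mul_nonneg ha (blochNorm_nonneg x))
  calc (∑ i, b i * blochVec x i) ^ 2 ≤ (∑ i, b i ^ 2) * ∑ i, blochVec x i ^ 2 :=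
        Finset.sum_mul_sq_le_sq_mul_sq _ _ _
    _ ≤ (a * blochNorm x) ^ 2 := by
        rw [sum_blochVec_sq, mul_pow]
        gcongr

theorem pauliMatrix_tensorVec (R : ℝ) (c s : Fin 3 → ℝ) (x y : Fin 2 → ℂ) :
    (star (tensorVec x y) ⬝ᵥ pauliMatrix R c s *ᵥ tensorVec x y).re =
      R * blochNorm x * blochNorm y
        + ∑ i, (blochNorm y * c i + s i * blochVec y i) * blochVec x i := by
  simp [pauliMatrix, tensorVec, blochNorm, blochVec, Fin.sum_univ_three, mulVec, dotProduct,
    Fin.sum_univ_four]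
  ring

theorem pauliMatrix_tensorVec_nonneg {R : ℝ} {c s : Fin 3 → ℝ} (hR : 0 ≤ R)
    (h : ∀ n : Fin 3 → ℝ, ∑ i, n i ^ 2 ≤ 1 → ∑ i, (c i + s i * n i) ^ 2 ≤ R ^ 2)
    (x y : Fin 2 → ℂ) :
    0 ≤ (star (tensorVec x y) ⬝ᵥ pauliMatrix R c s *ᵥ tensorVec x y).re := by
  rw [pauliMatrix_tensorVec]
  have hy := sum_blochVec_sq y
  have hb : ∑ i, (blochNorm y * c i + s i * blochVec y i) ^ 2 ≤ (R * blochNorm y) ^ 2 := by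
    rcases eq_or_ne (blochNorm y) 0 with h0 | h0
    · rw [h0, zero_pow two_ne_zero, Finset.sum_eq_zero_iff_of_nonneg (fun i _ => sq_nonneg _)] at hy
      have hz : ∀ i, blochVec y i = 0 := fun i => by simpa using hy i (Finset.mem_univ i)
      simp [h0, hz]
    · have := h (fun i => blochVec y i / blochNorm y) (by
        simp only [div_pow, ← Finset.sum_div, hy]
        exact div_self_le_one _)
      calc ∑ i, (blochNorm y * c i + s i * blochVec y i) ^ 2
          = blochNorm y ^ 2 * ∑ i, (c i + s i * (blochVec y i / blochNorm y)) ^ 2 := by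
            rw [Finset.mul_sum]
            refine Finset.sum_congr rfl fun i _ => ?_
            field_simp
        _ ≤ blochNorm y ^ 2 * R ^ 2 := by gcongr
        _ = _ := by ring
  have := neg_le_of_abs_le
    (abs_sum_mul_blochVec_le (mul_nonneg hR (blochNorm_nonneg y)) hb x)
  linarith

theorem exists_isotropic_combination (v w : Fin 4 → ℂ) :
    ∃ a b : ℂ, (a ≠ 0 ∨ b ≠ 0) ∧
      (a • v + b • w) 0 * (a • v + b • w) 3 = (a • v + b • w) 1 * (a • v + b • w) 2 := by
  by_cases h : v 0 * v 3 - v 1 * v 2 = 0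
  · exact ⟨1, 0, Or.inl one_ne_zero, by simpa using sub_eq_zero.1 h⟩
  · obtain ⟨d, hd⟩ := IsAlgClosed.exists_pow_nat_eq
      (discrim (v 0 * v 3 - v 1 * v 2) (v 0 * w 3 + w 0 * v 3 - v 1 * w 2 - w 1 * v 2)
        (w 0 * w 3 - w 1 * w 2)) two_pos
    obtain ⟨a, ha⟩ := exists_quadratic_eq_zero h ⟨d, by rw [← hd, pow_two]⟩
    refine ⟨a, 1, Or.inr one_ne_zero, ?_⟩
    simp only [Pi.add_apply, Pi.smul_apply, smul_eq_mul]
    linear_combination ha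

open scoped ComplexOrder in
/-- A Hermitian form of positive determinant that is nonnegative on isotropic vectors is positive
semidefinite: every plane contains an isotropic vector, so at most one eigenvalue is negative. -/
theorem Matrix.IsHermitian.posSemidef_of_isotropic_nonneg {H : Matrix (Fin 4) (Fin 4) ℂ}
    (hH : H.IsHermitian) (hdet : 0 < H.det.re)
    (h : ∀ w : Fin 4 → ℂ, w 0 * w 3 = w 1 * w 2 → 0 ≤ (star w ⬝ᵥ H *ᵥ w).re) :
    H.PosSemidef := by
  rw [hH.posSemidef_iff_eigenvalues_nonneg]
  by_contra hneg
  obtain ⟨i, hi⟩ : ∃ i, hH.eigenvalues i < 0 := by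
    simpa [Pi.le_def] using hneg
  have hprod : 0 < ∏ j, hH.eigenvalues j := by
    rw [hH.det_eq_prod_eigenvalues, ← RCLike.ofReal_prod] at hdet
    exact hdet
  obtain ⟨j, hji, hj⟩ : ∃ j, j ≠ i ∧ hH.eigenvalues j < 0 := by
    by_contra! hall
    rw [← Finset.mul_prod_erase _ _ (Finset.mem_univ i)] at hprod
    have := Finset.prod_nonneg (s := Finset.univ.erase i) (f := hH.eigenvalues)
      (fun j hj => hall j (Finset.ne_of_mem_erase hj))
    nlinarith
  have ho : ∀ k l, star (hH.eigenvectorBasis k).ofLp ⬝ᵥ (hH.eigenvectorBasis l).ofLp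
      = if k = l then 1 else 0 := by
    intro k l
    rw [← orthonormal_iff_ite.1 hH.eigenvectorBasis.orthonormal k l,
      EuclideanSpace.inner_eq_star_dotProduct, dotProduct_comm]
  obtain ⟨a, b, hab, hq⟩ := exists_isotropic_combination (hH.eigenvectorBasis i).ofLp
    (hH.eigenvectorBasis j).ofLp
  have hval := h _ hq
  have : star (a • (hH.eigenvectorBasis i).ofLp + b • (hH.eigenvectorBasis j).ofLp) ⬝ᵥ
      H *ᵥ (a • (hH.eigenvectorBasis i).ofLp + b • (hH.eigenvectorBasis j).ofLp)
      = ((‖a‖ ^ 2 * hH.eigenvalues i + ‖b‖ ^ 2 * hH.eigenvalues j : ℝ) : ℂ) := by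
    simp only [mulVec_add, mulVec_smul, hH.mulVec_eigenvectorBasis, star_add, star_smul,
      add_dotProduct, dotProduct_add, smul_dotProduct, dotProduct_smul, ho, if_neg hji,
      if_neg hji.symm, if_true]
    push_cast
    rw [← Complex.conj_mul' a, ← Complex.conj_mul' b]
    simp
    ring
  rw [this, Complex.ofReal_re] at hval
  have h1 : 0 ≤ ‖a‖ ^ 2 := by positivity
  have h2 : 0 ≤ ‖b‖ ^ 2 := by positivity
  rcases hab with ha | hb
  · have : 0 < ‖a‖ ^ 2 := by positivity
    nlinarith
  · have : 0 < ‖b‖ ^ 2 := by positivity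
    nlinarith

theorem expectation_tensorVec (x y : Fin 2 → ℂ) (n : Fin 3 → ℝ) (M : Matrix (Fin 4) (Fin 4) ℂ)
    (hM : ∀ a b, M a b = tensorVec x y a * star (tensorVec x y b)) :
    blochNorm x * (blochNorm y + ∑ j, blochVec y j * n j) =
        (1 + n 2) * ((M 0 0).re + (M 2 2).re) + (1 - n 2) * ((M 1 1).re + (M 3 3).re)
          + 2 * n 0 * ((M 1 0).re + (M 3 2).re) + 2 * n 1 * ((M 1 0).im + (M 3 2).im) ∧
      blochVec x 0 * (blochNorm y + ∑ j, blochVec y j * n j) =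
        2 * ((1 + n 2) * (M 2 0).re + (1 - n 2) * (M 3 1).re
          + n 0 * ((M 3 0).re + (M 2 1).re) + n 1 * ((M 3 0).im - (M 2 1).im)) ∧
      blochVec x 1 * (blochNorm y + ∑ j, blochVec y j * n j) =
        2 * ((1 + n 2) * (M 2 0).im + (1 - n 2) * (M 3 1).im
          + n 0 * ((M 3 0).im + (M 2 1).im) + n 1 * ((M 2 1).re - (M 3 0).re)) ∧
      blochVec x 2 * (blochNorm y + ∑ j, blochVec y j * n j) =
        (1 + n 2) * ((M 0 0).re - (M 2 2).re) + (1 - n 2) * ((M 1 1).re - (M 3 3).re)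
          + 2 * n 0 * ((M 1 0).re - (M 3 2).re) + 2 * n 1 * ((M 1 0).im - (M 3 2).im) := by
  simp only [hM]
  refine ⟨?_, ?_, ?_, ?_⟩ <;>
  · simp [tensorVec, blochNorm, blochVec, Fin.sum_univ_three]
    ring

open scoped ComplexOrder in
/-- Decomposition of a positive `pauliMatrix` into four product states. -/
theorem exists_bloch_decomposition {R : ℝ} {c t : Fin 3 → ℝ} (hR : 0 < R) (ht : ∀ i, 0 < t i)
    (h : ∀ n : Fin 3 → ℝ, ∑ i, n i ^ 2 ≤ 1 → ∑ i, (c i + t i * n i) ^ 2 ≤ R ^ 2)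
    (hp : 0 ≤ nestedPoly R c t) :
    ∃ x y : Fin 4 → Fin 2 → ℂ, ∀ n : Fin 3 → ℝ,
      ∑ k, blochNorm (x k) * (blochNorm (y k) + ∑ j, blochVec (y k) j * n j) = 4 * R ∧
      ∀ i, ∑ k, blochVec (x k) i * (blochNorm (y k) + ∑ j, blochVec (y k) j * n j) =
        4 * (c i - t i * n i) := by
  have hneg : 0 < nestedPoly R c (-t) := by
    have h1 : nestedPoly R c (-t) = nestedPoly R c t + 16 * (R * (t 0 * t 1 * t 2)) := by
      simp [nestedPoly, Fin.sum_univ_three, Fin.prod_univ_three]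
      ring
    have := ht 0
    have := ht 1
    have := ht 2
    have : 0 < 16 * (R * (t 0 * t 1 * t 2)) := by positivity
    linarith
  have hpsd : (pauliMatrix R c (-t)).PosSemidef := by
    refine (pauliMatrix_isHermitian R c (-t)).posSemidef_of_isotropic_nonneg ?_ ?_
    · rw [det_pauliMatrix]
      exact hneg
    · intro w hw
      obtain ⟨x, y, rfl⟩ := exists_eq_tensorVec hw
      refine pauliMatrix_tensorVec_nonneg hR.le (fun n hn => ?_) x y
      have := h (-n) (by simpa using hn)
      simpa using this
  obtain ⟨W, hW, hiso⟩ := exists_isotropic_decomposition hpsd detForm_transpose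
    detForm_conjTranspose det_detForm
    (by rw [pauliMatrix_spinFlip, trace_pauliMatrix_mul R c (-t)])
    (by rw [pauliMatrix_spinFlip, trace_pauliMatrix_mul_sq R c (-t)])
    (by
      rw [det_pauliMatrix, Complex.ofReal_re, neg_neg]
      linarith)
  have hprod : ∀ k, W 0 k * W 3 k = W 1 k * W 2 k := by
    intro k
    have := hiso k
    simp [Matrix.mul_apply, detForm, Fin.sum_univ_four] at this
    linear_combination this / 2
  choose x y hxy using fun k => exists_eq_tensorVec (w := fun a => W a k) (hprod k)
  have hxy' : ∀ k a, tensorVec (x k) (y k) a = W a k := fun k a => (congrFun (hxy k) a).symm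
  refine ⟨x, y, fun n => ?_⟩
  have key := fun k => expectation_tensorVec (x k) (y k) n
    (fun a b => tensorVec (x k) (y k) a * star (tensorVec (x k) (y k) b)) (fun _ _ => rfl)
  have hH : ∀ a b, ∑ k, tensorVec (x k) (y k) a * star (tensorVec (x k) (y k) b)
      = pauliMatrix R c (-t) a b := by
    intro a b
    rw [hW, Matrix.mul_apply]
    simp only [hxy', conjTranspose_apply]
  have hre : ∀ a b, ∑ k, (tensorVec (x k) (y k) a * star (tensorVec (x k) (y k) b)).re
      = (pauliMatrix R c (-t) a b).re := fun a b => by rw [← hH, Complex.re_sum]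
  have him : ∀ a b, ∑ k, (tensorVec (x k) (y k) a * star (tensorVec (x k) (y k) b)).im
      = (pauliMatrix R c (-t) a b).im := fun a b => by rw [← hH, Complex.im_sum]
  refine ⟨?_, fun i => ?_⟩
  · simp only [(key _).1, Finset.sum_add_distrib, ← Finset.mul_sum, hre, him]
    simp [pauliMatrix]
    ring
  · fin_cases i
    · simp only [Fin.zero_eta, (key _).2.1, Finset.sum_add_distrib, Finset.sum_sub_distrib,
        ← Finset.mul_sum, hre, him]
      simp [pauliMatrix]
      ring
    · simp only [Fin.mk_one, (key _).2.2.1, Finset.sum_add_distrib, Finset.sum_sub_distrib,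
        ← Finset.mul_sum, hre, him]
      simp [pauliMatrix]
      ring
    · simp only [Fin.reduceFinMk, (key _).2.2.2, Finset.sum_add_distrib, Finset.sum_sub_distrib,
        ← Finset.mul_sum, hre, him]
      simp [pauliMatrix]
      ring

/-- A solid ellipsoid with axes along the coordinate axes, contained in the ball of radius `R`, is
contained in an inscribed tetrahedron if its nested tetrahedron polynomial is nonnegative. -/
theorem exists_inscribed_tetrahedron {R : ℝ} {c t : Fin 3 → ℝ} (hR : 0 < R) (ht : ∀ i, 0 < t i)
    (h : ∀ n : Fin 3 → ℝ, ∑ i, n i ^ 2 ≤ 1 → ∑ i, (c i + t i * n i) ^ 2 ≤ R ^ 2)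
    (hp : 0 ≤ nestedPoly R c t) :
    ∃ p : Fin 4 → Fin 3 → ℝ, (∀ k, ∑ i, p k i ^ 2 = R ^ 2) ∧
      ∀ n : Fin 3 → ℝ, ∑ i, n i ^ 2 ≤ 1 →
        (fun i => c i + t i * n i) ∈ convexHull ℝ (Set.range p) := by
  obtain ⟨x, y, hxy⟩ := exists_bloch_decomposition hR ht h hp
  have hvert : ∀ k, ∃ p : Fin 3 → ℝ, ∑ i, p i ^ 2 = R ^ 2 ∧
      ∀ i, blochNorm (x k) * p i = R * blochVec (x k) i := by
    intro k
    have hx := sum_blochVec_sq (x k)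
    rcases eq_or_ne (blochNorm (x k)) 0 with h0 | h0
    · rw [h0, zero_pow two_ne_zero, Finset.sum_eq_zero_iff_of_nonneg (fun i _ => sq_nonneg _)] at hx
      have hz : ∀ i, blochVec (x k) i = 0 := fun i => by simpa using hx i (Finset.mem_univ i)
      exact ⟨![R, 0, 0], by simp [Fin.sum_univ_three], fun i => by simp [h0, hz]⟩
    · refine ⟨fun i => R * blochVec (x k) i / blochNorm (x k), ?_, fun i => by field_simp⟩
      simp only [div_pow, mul_pow, ← Finset.sum_div, ← Finset.mul_sum, hx]
      field_simp
  choose p hpR hpx using hvert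
  refine ⟨p, hpR, fun n hn => ?_⟩
  obtain ⟨h0, h1⟩ := hxy (-n)
  set g : Fin 4 → ℝ := fun k => blochNorm (y k) + ∑ j, blochVec (y k) j * (-n) j with hg
  have hgpos : ∀ k, 0 ≤ g k := by
    intro k
    have := neg_le_of_abs_le (abs_sum_mul_blochVec_le (a := 1) (b := -n) zero_le_one
      (by simpa using hn) (y k))
    simp only [hg, mul_comm (blochVec (y k) _)]
    linarith
  have hpt : (fun i => c i + t i * n i) = ∑ k, (blochNorm (x k) * g k / (4 * R)) • p k := by
    ext i
    have : ∀ k, blochNorm (x k) * g k / (4 * R) * p k i = blochVec (x k) i * g k / 4 := by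
      intro k
      field_simp
      linear_combination g k * hpx k i
    simp only [Finset.sum_apply, Pi.smul_apply, smul_eq_mul, this, ← Finset.sum_div]
    rw [h1 i]
    simp
  rw [hpt]
  refine (convex_convexHull ℝ _).sum_mem (fun k _ => ?_) ?_ (fun k _ => ?_)
  · have := blochNorm_nonneg (x k)
    have := hgpos k
    positivity
  · rw [← Finset.sum_div, h0, div_self (by positivity)]
  · exact subset_convexHull ℝ _ (Set.mem_range_self k)

theorem exists_weights_of_mem_convexHull_range {ι V : Type*} [Fintype ι] [AddCommGroup V]
    [Module ℝ V] {p : ι → V} {x : V} (hx : x ∈ convexHull ℝ (Set.range p)) :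
    ∃ w : ι → ℝ, (∀ k, 0 ≤ w k) ∧ ∑ k, w k = 1 ∧ ∑ k, w k • p k = x := by
  classical
  have hsub : convexHull ℝ (Set.range p) ⊆ Fintype.linearCombination ℝ p '' stdSimplex ℝ ι := by
    refine convexHull_min ?_ ((convex_stdSimplex ℝ ι).linear_image _)
    rintro _ ⟨k, rfl⟩
    exact ⟨Pi.single k 1, single_mem_stdSimplex ℝ k, by simp⟩
  obtain ⟨w, hw, rfl⟩ := hsub hx
  exact ⟨w, hw.1, hw.2, by simp [Fintype.linearCombination_apply]⟩

/-- The Hermitian matrix `a + ∑ bᵢ σᵢ` in Pauli matrices `σᵢ`. -/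
noncomputable def qubitMatrix (a : ℝ) (b : Fin 3 → ℝ) : Matrix (Fin 2) (Fin 2) ℂ :=
  !![a + b 2, b 0 - b 1 * Complex.I; b 0 + b 1 * Complex.I, a - b 2]

open scoped ComplexOrder in
theorem qubitMatrix_posSemidef {a : ℝ} {b : Fin 3 → ℝ} (ha : 0 ≤ a)
    (hb : ∑ i, b i ^ 2 ≤ a ^ 2) : (qubitMatrix a b).PosSemidef := by
  refine PosSemidef.of_dotProduct_mulVec_nonneg ?_ fun x => ?_
  · ext i j
    fin_cases i <;> fin_cases j <;> simp [qubitMatrix, ← sub_eq_add_neg]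
  · have : star x ⬝ᵥ (qubitMatrix a b *ᵥ x) =
        ((a * blochNorm x + ∑ i, b i * blochVec x i : ℝ) : ℂ) := by
      apply Complex.ext
      · rw [Complex.ofReal_re]
        simp [qubitMatrix, blochNorm, blochVec, Fin.sum_univ_three, dotProduct, mulVec]
        ring
      · rw [Complex.ofReal_im]
        simp [qubitMatrix, dotProduct, mulVec]
        ring
    rw [this, Complex.zero_le_real]
    linarith [neg_le_of_abs_le (abs_sum_mul_blochVec_le ha hb x)]

/-- The standard enumeration of a basis of a tensor product `ℂ² ⊗ ℂ²`. -/
def tensorIndex : Fin 4 → Fin 2 × Fin 2 := ![(0, 0), (0, 1), (1, 0), (1, 1)]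

open scoped Kronecker in
theorem pauliMatrix_eq_sum {R : ℝ} {c t : Fin 3 → ℝ} {p β : Fin 4 → Fin 3 → ℝ} {α : Fin 4 → ℝ}
    (hα : ∑ k, α k = 1) (hβ : ∀ j, ∑ k, β k j = 0) (hpα : ∀ i, ∑ k, α k * p k i = c i)
    (hpβ : ∀ i j, ∑ k, β k j * p k i = if i = j then t i else 0) :
    pauliMatrix R c t = ∑ k, (qubitMatrix R (p k) ⊗ₖ qubitMatrix (α k) (β k)).submatrix
      tensorIndex tensorIndex := by
  have hRα : ∑ k, R * α k = R := by rw [← Finset.mul_sum, hα, mul_one]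
  have hRβ : ∀ j, ∑ k, R * β k j = 0 := fun j => by rw [← Finset.mul_sum, hβ, mul_zero]
  ext a b
  rw [Matrix.sum_apply]
  simp only [Fin.forall_fin_succ, Fin.sum_univ_four] at *
  simp at hα hβ hpα hpβ hRα hRβ
  fin_cases a <;> fin_cases b <;> apply Complex.ext <;>
    simp [pauliMatrix, qubitMatrix, tensorIndex] <;> linarith

/-- If the affine function `n ↦ α + ∑ βᵢ nᵢ` is nonnegative on the unit ball, `|β| ≤ α`. -/
theorem sum_sq_le_sq_of_nonneg_on_ball {α : ℝ} {β : Fin 3 → ℝ}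
    (h : ∀ n : Fin 3 → ℝ, ∑ i, n i ^ 2 ≤ 1 → 0 ≤ α + ∑ i, β i * n i) :
    ∑ i, β i ^ 2 ≤ α ^ 2 := by
  set r := √(∑ i, β i ^ 2) with hr
  have hr2 : r ^ 2 = ∑ i, β i ^ 2 := Real.sq_sqrt (Finset.sum_nonneg fun i _ => sq_nonneg _)
  rw [← hr2]
  rcases eq_or_lt_of_le (Real.sqrt_nonneg (∑ i, β i ^ 2)) with h0 | h0
  · rw [hr, ← h0, zero_pow two_ne_zero]
    positivity
  · have := h (fun i => -(β i / r)) (by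
      simp only [neg_sq, div_pow, ← Finset.sum_div, ← hr2]
      exact div_self_le_one _)
    have hs : ∑ i, β i * -(β i / r) = -r := by
      have : ∀ i, β i * -(β i / r) = -(β i ^ 2 / r) := fun i => by ring
      simp only [this, Finset.sum_neg_distrib, ← Finset.sum_div, ← hr2]
      rw [pow_two, mul_div_assoc, div_self h0.ne', mul_one]
    rw [hs] at this
    exact pow_le_pow_left₀ h0.le (by linarith) 2

/-- Barycentric coordinates with respect to a tetrahedron that contains a solid ellipsoid are affine
functions on the ellipsoid. -/
theorem exists_affine_weights {c t : Fin 3 → ℝ} (ht : ∀ i, 0 < t i) {p : Fin 4 → Fin 3 → ℝ}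
    (h : ∀ n : Fin 3 → ℝ, ∑ i, n i ^ 2 ≤ 1 →
      (fun i => c i + t i * n i) ∈ convexHull ℝ (Set.range p)) :
    ∃ (α : Fin 4 → ℝ) (β : Fin 4 → Fin 3 → ℝ), ∑ k, α k = 1 ∧ (∀ j, ∑ k, β k j = 0) ∧
      (∀ i, ∑ k, α k * p k i = c i) ∧
      (∀ i j, ∑ k, β k j * p k i = if i = j then t i else 0) ∧
      ∀ n : Fin 3 → ℝ, ∑ i, n i ^ 2 ≤ 1 → ∀ k, 0 ≤ α k + ∑ j, β k j * n j := by
  choose! w hw0 hw1 hwp using fun n hn => exists_weights_of_mem_convexHull_range (h n hn)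
  replace hwp : ∀ n : Fin 3 → ℝ, ∑ i, n i ^ 2 ≤ 1 → ∀ i, ∑ k, w n k * p k i = c i + t i * n i := by
    intro n hn i
    simpa using congrFun (hwp n hn) i
  have hz : ∑ i, (0 : Fin 3 → ℝ) i ^ 2 ≤ 1 := by simp
  have he : ∀ j, ∑ i, (Pi.single j 1 : Fin 3 → ℝ) i ^ 2 ≤ 1 := fun j => by
    simp [Pi.single_apply]
  set α : Fin 4 → ℝ := w 0 with hα
  set β : Fin 4 → Fin 3 → ℝ := fun k j => w (Pi.single j 1) k - w 0 k with hβ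
  have h1 : ∑ k, α k = 1 := hw1 0 hz
  have h2 : ∀ j, ∑ k, β k j = 0 := fun j => by
    simp [hβ, Finset.sum_sub_distrib, hw1 0 hz, hw1 _ (he j)]
  have h3 : ∀ i, ∑ k, α k * p k i = c i := fun i => by simp [hα, hwp 0 hz]
  have h4 : ∀ i j, ∑ k, β k j * p k i = if i = j then t i else 0 := fun i j => by
    simp [hβ, sub_mul, Finset.sum_sub_distrib, hwp 0 hz, hwp _ (he j), Pi.single_apply]
  refine ⟨α, β, h1, h2, h3, h4, fun n hn k => ?_⟩
  let P : Matrix (Fin 4) (Fin 4) ℝ := of fun r k => (Fin.cons 1 (p k) : Fin 4 → ℝ) r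
  let B : Matrix (Fin 4) (Fin 4) ℝ := of fun k r =>
    (Fin.cons (α k - ∑ j, c j / t j * β k j) (fun j => β k j / t j) : Fin 4 → ℝ) r
  have hPB : P * B = 1 := by
    have ht' := fun i => (ht i).ne'
    have hcancel : ∀ (f : Fin 4 → ℝ), ∑ k, (α k - ∑ j, c j / t j * β k j) * f k =
        ∑ k, α k * f k - ∑ j, c j / t j * ∑ k, β k j * f k := by
      intro f
      simp only [sub_mul, Finset.sum_sub_distrib, Finset.sum_mul, Finset.mul_sum]
      rw [Finset.sum_comm]
      simp only [mul_assoc]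
    ext r s
    rw [Matrix.mul_apply]
    simp only [P, B, of_apply]
    refine Fin.cases ?_ (fun i => ?_) r <;> refine Fin.cases ?_ (fun j => ?_) s
    · have := hcancel 1
      simp only [Pi.one_apply, mul_one, h1, h2, mul_zero, Finset.sum_const_zero] at this
      simpa using this
    · simp [← Finset.sum_div, h2, (Fin.succ_ne_zero j).symm]
    · have := hcancel fun k => p k i
      simp only [h3, h4, mul_ite, mul_zero, Finset.sum_ite_eq, Finset.mem_univ, if_true,
        div_mul_cancel₀ _ (ht' i), sub_self] at this
      simpa [mul_comm, Matrix.one_apply] using this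
    · have : ∀ k, p k i * (β k j / t j) = β k j * p k i / t j := fun k => by ring
      simp only [Fin.cons_succ, this, ← Finset.sum_div, h4, Matrix.one_apply, Fin.succ_inj]
      split_ifs with hij
      · rw [hij, div_self (ht' j)]
      · rw [zero_div]
  have hBP : B * P = 1 := mul_eq_one_comm.1 hPB
  have hPw : P *ᵥ w n = (Fin.cons 1 (fun i => c i + t i * n i) : Fin 4 → ℝ) := by
    ext r
    refine Fin.cases ?_ (fun i => ?_) r
    · simpa [P, mulVec, dotProduct] using hw1 n hn
    · simpa [P, mulVec, dotProduct, mul_comm] using hwp n hn i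
  have hwn : w n = B *ᵥ (Fin.cons 1 (fun i => c i + t i * n i) : Fin 4 → ℝ) := by
    rw [← hPw, mulVec_mulVec, hBP, one_mulVec]
  have : w n k = α k + ∑ j, β k j * n j := by
    have ht' := fun i => (ht i).ne'
    rw [hwn]
    simp only [mulVec, dotProduct, B, of_apply, Fin.sum_univ_succ (n := 3), Fin.cons_zero,
      Fin.cons_succ, mul_one, sub_add, ← Finset.sum_sub_distrib]
    rw [sub_eq_add_neg, ← Finset.sum_neg_distrib]
    congr 1
    refine Finset.sum_congr rfl fun j _ => ?_
    have := ht' j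
    field_simp
    ring
  rw [← this]
  exact hw0 n hn k

open scoped ComplexOrder in
/-- The nested tetrahedron polynomial of a solid ellipsoid contained in a tetrahedron inscribed in
the sphere of radius `R` is nonnegative. -/
theorem nestedPoly_nonneg_of_inscribed_tetrahedron {R : ℝ} {c t : Fin 3 → ℝ} (hR : 0 < R)
    (ht : ∀ i, 0 < t i) {p : Fin 4 → Fin 3 → ℝ} (hp : ∀ k, ∑ i, p k i ^ 2 = R ^ 2)
    (h : ∀ n : Fin 3 → ℝ, ∑ i, n i ^ 2 ≤ 1 →
      (fun i => c i + t i * n i) ∈ convexHull ℝ (Set.range p)) :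
    0 ≤ nestedPoly R c t := by
  obtain ⟨α, β, h1, h2, h3, h4, h5⟩ := exists_affine_weights ht h
  have hα : ∀ k, 0 ≤ α k := fun k => by simpa using h5 0 (by simp) k
  have hpsd : (pauliMatrix R c t).PosSemidef := by
    rw [pauliMatrix_eq_sum h1 h2 h3 h4]
    refine posSemidef_sum _ fun k _ => ((qubitMatrix_posSemidef hR.le (hp k).le).kronecker
      (qubitMatrix_posSemidef (hα k) ?_)).submatrix _
    exact sum_sq_le_sq_of_nonneg_on_ball fun n hn => h5 n hn k
  have := hpsd.det_nonneg
  rwa [det_pauliMatrix, Complex.zero_le_real] at this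

theorem exists_inscribed_tetrahedron_iff {R : ℝ} {c t : Fin 3 → ℝ} (hR : 0 < R)
    (ht : ∀ i, 0 < t i)
    (h : ∀ n : Fin 3 → ℝ, ∑ i, n i ^ 2 ≤ 1 → ∑ i, (c i + t i * n i) ^ 2 ≤ R ^ 2) :
    (∃ p : Fin 4 → Fin 3 → ℝ, (∀ k, ∑ i, p k i ^ 2 = R ^ 2) ∧
      ∀ n : Fin 3 → ℝ, ∑ i, n i ^ 2 ≤ 1 →
        (fun i => c i + t i * n i) ∈ convexHull ℝ (Set.range p)) ↔ 0 ≤ nestedPoly R c t :=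
  ⟨fun ⟨_, hp, hE⟩ => nestedPoly_nonneg_of_inscribed_tetrahedron hR ht hp hE,
    exists_inscribed_tetrahedron hR ht h⟩

theorem dotProduct_mulVec_eq_sum_repr {ι : Type*} [Fintype ι] {M : Matrix ι ι ℝ} {μ : ι → ℝ}
    {b : OrthonormalBasis ι ℝ (EuclideanSpace ℝ ι)}
    (hb : ∀ i, M *ᵥ (b i).ofLp = μ i • (b i).ofLp)
    (v : EuclideanSpace ℝ ι) : v.ofLp ⬝ᵥ M *ᵥ v.ofLp = ∑ i, μ i * b.repr v i ^ 2 := by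
  have hv : v.ofLp = ∑ i, b.repr v i • (b i).ofLp := by
    conv_lhs => rw [← b.sum_repr v]
    simp
  have hvb : ∀ i, v.ofLp ⬝ᵥ (b i).ofLp = b.repr v i := fun i => by
    rw [b.repr_apply_apply, EuclideanSpace.inner_eq_star_dotProduct]
    simp
  have hM : M *ᵥ v.ofLp = ∑ i, (b.repr v i * μ i) • (b i).ofLp := by
    rw [hv, mulVec_sum]
    exact Finset.sum_congr rfl fun i _ => by rw [mulVec_smul, hb, smul_smul]
  rw [hM, dotProduct_sum]
  refine Finset.sum_congr rfl fun i _ => ?_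
  rw [dotProduct_smul, hvb, smul_eq_mul]
  ring

theorem trace_eq_sum_of_orthonormalBasis {ι : Type*} [Fintype ι] [DecidableEq ι]
    {M : Matrix ι ι ℝ} {μ : ι → ℝ}
    {b : OrthonormalBasis ι ℝ (EuclideanSpace ℝ ι)}
    (hb : ∀ i, M *ᵥ (b i).ofLp = μ i • (b i).ofLp) :
    M.trace = ∑ i, μ i := by
  have h := (toEuclideanLin M).trace_eq_sum_inner b
  have h1 : LinearMap.trace ℝ _ (toEuclideanLin M) = M.trace := by
    rw [toEuclideanLin_eq_toLin_orthonormal, trace_toLin_eq]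
  rw [← h1, h]
  refine Finset.sum_congr rfl fun i _ => ?_
  have : toEuclideanLin M (b i) = μ i • b i := by
    ext j
    simpa using congrFun (hb i) j
  rw [this, inner_smul_right, real_inner_self_eq_norm_sq, b.norm_eq_one]
  simp

/-- **Nested tetrahedron criterion for an ellipsoid in a sphere.**
Let `Q` be a real symmetric positive definite 3×3 matrix and `E` the ellipsoid
`{x : (x − c)ᵀ Q⁻¹ (x − c) ≤ 1}` with centre `c`, contained in the closed ball of
radius `R > 0` about the origin.  With `d = ‖c‖`,
`u = R² − tr Q + 2 d̂ᵀ Q d̂` (the skew term taken to be `0` when `d = 0`) and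
`q = R⁴ − 2R² tr Q − 8R √(det Q) + 2 tr(Q²) − (tr Q)²`,
a tetrahedron with all four vertices on the sphere of radius `R` contains `E`
iff `d⁴ − 2u d² + q ≥ 0`. -/
theorem nested_tetrahedron_ellipsoid_in_sphere
    (Q : Matrix (Fin 3) (Fin 3) ℝ) (hQsymm : Q.IsSymm) (hQpd : Q.PosDef)
    (c : EuclideanSpace ℝ (Fin 3)) (R : ℝ) (hR : 0 < R)
    (E : Set (EuclideanSpace ℝ (Fin 3)))
    (hE : E = {x | (fun i => x i - c i) ⬝ᵥ Q⁻¹.mulVec (fun i => x i - c i) ≤ 1})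
    (hEB : E ⊆ Metric.closedBall 0 R)
    (d u q : ℝ)
    (hd : d = ‖c‖)
    (hu : u = R ^ 2 - Q.trace +
      (if d = 0 then 0
       else 2 * ((fun i => c i / d) ⬝ᵥ Q.mulVec (fun i => c i / d))))
    (hq : q = R ^ 4 - 2 * R ^ 2 * Q.trace - 8 * R * Real.sqrt Q.det
      + 2 * (Q * Q).trace - Q.trace ^ 2) :
    (∃ p : Fin 4 → EuclideanSpace ℝ (Fin 3),
        (∀ i, p i ∈ Metric.sphere (0 : EuclideanSpace ℝ (Fin 3)) R) ∧
        E ⊆ convexHull ℝ (Set.range p)) ↔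
      d ^ 4 - 2 * u * d ^ 2 + q ≥ 0 := by
  have hQ : Q.IsHermitian := hQpd.isHermitian
  have hev : ∀ i, 0 < hQ.eigenvalues i := hQpd.eigenvalues_pos
  set b := hQ.eigenvectorBasis with hb
  set t : Fin 3 → ℝ := fun i => √(hQ.eigenvalues i) with ht
  have ht0 : ∀ i, 0 < t i := fun i => Real.sqrt_pos.2 (hev i)
  have ht2 : ∀ i, hQ.eigenvalues i = t i ^ 2 := fun i => (Real.sq_sqrt (hev i).le).symm
  have hbQ : ∀ i, Q *ᵥ (b i).ofLp = (t i ^ 2) • (b i).ofLp := fun i => by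
    rw [← ht2]
    exact hQ.mulVec_eigenvectorBasis i
  have hbQ2 : ∀ i, (Q * Q) *ᵥ (b i).ofLp = (t i ^ 4) • (b i).ofLp := fun i => by
    rw [← mulVec_mulVec, hbQ, mulVec_smul, hbQ, smul_smul]
    congr 1
    ring
  have hbQi : ∀ i, Q⁻¹ *ᵥ (b i).ofLp = (t i ^ 2)⁻¹ • (b i).ofLp := fun i => by
    have h1 : Q⁻¹ *ᵥ (Q *ᵥ (b i).ofLp) = (b i).ofLp := by
      rw [mulVec_mulVec, nonsing_inv_mul _ (isUnit_iff_ne_zero.2 hQpd.det_pos.ne'), one_mulVec]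
    rw [hbQ, mulVec_smul] at h1
    rw [eq_inv_smul_iff₀ (pow_ne_zero 2 (ht0 i).ne'), h1]
  let L : EuclideanSpace ℝ (Fin 3) ≃ₗ[ℝ] (Fin 3 → ℝ) :=
    b.repr.toLinearEquiv.trans (WithLp.linearEquiv 2 ℝ (Fin 3 → ℝ))
  have hL : ∀ x i, L x i = b.repr x i := fun x i => rfl
  have hnorm : ∀ x, ∑ i, L x i ^ 2 = ‖x‖ ^ 2 := fun x => by
    rw [← b.repr.norm_map, EuclideanSpace.real_norm_sq_eq]
    rfl
  have hmem : ∀ x, x ∈ E ↔ ∑ i, ((L x i - L c i) / t i) ^ 2 ≤ 1 := fun x => by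
    have := dotProduct_mulVec_eq_sum_repr hbQi (x - c)
    rw [hE, Set.mem_ofPred_eq]
    change (x - c).ofLp ⬝ᵥ Q⁻¹ *ᵥ (x - c).ofLp ≤ 1 ↔ _
    rw [this]
    simp only [div_eq_inv_mul, mul_pow, inv_pow, map_sub, hL]
    rfl
  have hpoly : d ^ 4 - 2 * u * d ^ 2 + q = nestedPoly R (L c) t := by
    have h1 : Q.trace = ∑ i, t i ^ 2 := trace_eq_sum_of_orthonormalBasis hbQ
    have h2 : (Q * Q).trace = ∑ i, t i ^ 4 := trace_eq_sum_of_orthonormalBasis hbQ2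
    have h3 : √Q.det = ∏ i, t i := by
      rw [hQ.det_eq_prod_eigenvalues, ← Real.sqrt_sq (Finset.prod_nonneg fun i _ => (ht0 i).le),
        ← Finset.prod_pow]
      simp only [← ht2]
      rfl
    have h4 : d ^ 2 = ∑ i, L c i ^ 2 := by rw [hd, hnorm]
    have h5 : u * d ^ 2 = (R ^ 2 - ∑ i, t i ^ 2) * ∑ i, L c i ^ 2
        + 2 * ∑ i, t i ^ 2 * L c i ^ 2 := by
      have h6 : c.ofLp ⬝ᵥ Q *ᵥ c.ofLp = ∑ i, t i ^ 2 * L c i ^ 2 :=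
        dotProduct_mulVec_eq_sum_repr hbQ c
      rw [← h6, ← h4, ← h1, hu]
      split_ifs with hd0
      · have hc : c = 0 := norm_eq_zero.1 (hd ▸ hd0)
        simp [hd0, hc]
      · have : (fun i => c i / d) = d⁻¹ • c.ofLp := by
          ext i
          simp [div_eq_inv_mul]
        rw [this, mulVec_smul, dotProduct_smul, smul_dotProduct, smul_eq_mul, smul_eq_mul]
        field_simp
    rw [nestedPoly, ← h5, ← h4, hq, h1, h2, h3]
    ring
  have hellipsoid : ∀ n : Fin 3 → ℝ, ∑ i, n i ^ 2 ≤ 1 →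
      L.symm (fun i => L c i + t i * n i) ∈ E := fun n hn => by
    rw [hmem]
    simpa [(ht0 _).ne'] using hn
  have hball : ∀ n : Fin 3 → ℝ, ∑ i, n i ^ 2 ≤ 1 → ∑ i, (L c i + t i * n i) ^ 2 ≤ R ^ 2 := by
    intro n hn
    have h1 := hEB (hellipsoid n hn)
    rw [mem_closedBall_zero_iff] at h1
    have h2 := hnorm (L.symm fun i => L c i + t i * n i)
    rw [L.apply_symm_apply] at h2
    rw [h2]
    gcongr
  have hsphere : ∀ x, x ∈ Metric.sphere (0 : EuclideanSpace ℝ (Fin 3)) R ↔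
      ∑ i, L x i ^ 2 = R ^ 2 := fun x => by
    rw [mem_sphere_zero_iff_norm, hnorm, sq_eq_sq₀ (norm_nonneg x) hR.le]
  have hhull : ∀ (p : Fin 4 → EuclideanSpace ℝ (Fin 3)) (x : EuclideanSpace ℝ (Fin 3)),
      x ∈ convexHull ℝ (Set.range p) ↔ L x ∈ convexHull ℝ (Set.range fun k => L (p k)) := by
    intro p x
    have := L.toLinearMap.image_convexHull (Set.range p)
    rw [← Set.range_comp] at this
    change _ = convexHull ℝ (Set.range fun k => L (p k)) at this
    rw [← this]
    exact (L.injective.mem_set_image).symm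
  rw [ge_iff_le, hpoly, ← exists_inscribed_tetrahedron_iff hR ht0 hball]
  constructor
  · rintro ⟨p, hp, hEp⟩
    refine ⟨fun k => L (p k), fun k => (hsphere _).1 (hp k), fun n hn => ?_⟩
    simpa using (hhull _ _).1 (hEp (hellipsoid n hn))
  · rintro ⟨p, hp, hEp⟩
    refine ⟨fun k => L.symm (p k), fun k => (hsphere _).2 (by simpa using hp k), fun x hx => ?_⟩
    have := hEp _ ((hmem x).1 hx)
    rw [hhull]
    simpa [mul_div_cancel₀, (ht0 _).ne'] using this
end

section
/- Let Q be a real symmetric positive semidefinite 3×3 matrix of rank 2 and let E be the degenerate ellipsoid (a filled ellipse) with centre c given by {c + v : v in the column space of Q, vᵀ Q⁺ v ≤ 1}, where Q⁺ denotes the Moore–Penrose pseudoinverse. Let B be the sphere of radius R > 0 centred at the origin, and suppose E is contained in the closed ball bounded by B. Set d = |c| and, when d ≠ 0, let d̂ = c/d. Define u = R² − tr Q + 2 d̂ᵀ Q d̂ and q = R⁴ − 2R² tr Q − 8R √(det Q) + 2 tr(Q²) − (tr Q)² (note det Q = 0 here). Then there exists a triangle (the convex hull of three points each lying on the sphere B)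 containing E if and only if d⁴ − 2u d² + q ≥ 0. -/
open Matrix

/-- `P` is the Moore–Penrose pseudoinverse of the real matrix `Q`
(the four Penrose conditions; transpose serves as conjugate-transpose for
real matrices). -/
def IsMoorePenroseInv (Q P : Matrix (Fin 3) (Fin 3) ℝ) : Prop :=
  Q * P * Q = Q ∧ P * Q * P = P ∧ (Q * P)ᵀ = Q * P ∧ (P * Q)ᵀ = P * Q

open ComplexConjugate

theorem exists_three_roots (A B C : ℂ) : ∃ x y z : ℂ,
    x + y + z = A ∧ x * y + x * z + y * z = B ∧ x * y * z = C := by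
  let P : Cubic ℂ := ⟨1, -A, B, -C⟩
  have ha : P.a ≠ 0 := one_ne_zero
  obtain ⟨x, y, z, h⟩ := (Cubic.splits_iff_roots_eq_three (φ := RingHom.id ℂ) ha).1
    (IsAlgClosed.splits _)
  have h1 := Cubic.b_eq_three_roots ha h
  have h2 := Cubic.c_eq_three_roots ha h
  have h3 := Cubic.d_eq_three_roots ha h
  simp only [P, RingHom.id_apply, one_mul, neg_inj] at h1 h2 h3
  exact ⟨x, y, z, h1.symm, h2.symm, h3.symm⟩

theorem normSq_sub_normSq_one_sub (f z : ℂ) :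
    ‖1 - conj f * z‖ ^ 2 - ‖z - f‖ ^ 2 = (1 - ‖f‖ ^ 2) * (1 - ‖z‖ ^ 2) := by
  simp only [← Complex.normSq_eq_norm_sq, Complex.normSq_apply]
  simp
  ring

theorem norm_eq_one_of_blaschke {f g z : ℂ} (hf : ‖f‖ < 1) (hg : ‖g‖ < 1)
    (h : z * (z - f) * (z - g) = (1 - conj f * z) * (1 - conj g * z)) : ‖z‖ = 1 := by
  have hF : 0 < 1 - ‖f‖ ^ 2 := by nlinarith [norm_nonneg f]
  have hG : 0 < 1 - ‖g‖ ^ 2 := by nlinarith [norm_nonneg g]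
  have h1 := normSq_sub_normSq_one_sub f z
  have h2 := normSq_sub_normSq_one_sub g z
  have h3 : (‖z‖ * ‖z - f‖ * ‖z - g‖) = ‖1 - conj f * z‖ * ‖1 - conj g * z‖ := by
    rw [← norm_mul, ← norm_mul, ← norm_mul, h]
  have hz := norm_nonneg z
  rcases lt_trichotomy ‖z‖ 1 with h0 | h0 | h0
  · exfalso
    have hZ : 0 < 1 - ‖z‖ ^ 2 := by nlinarith
    have h4 : ‖z - f‖ < ‖1 - conj f * z‖ :=
      lt_of_pow_lt_pow_left₀ 2 (norm_nonneg _) (by nlinarith [mul_pos hF hZ])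
    have h5 : ‖z - g‖ < ‖1 - conj g * z‖ :=
      lt_of_pow_lt_pow_left₀ 2 (norm_nonneg _) (by nlinarith [mul_pos hG hZ])
    have h6 := mul_lt_mul'' h4 h5 (norm_nonneg _) (norm_nonneg _)
    have h7 : 0 ≤ ‖z - f‖ * ‖z - g‖ := by positivity
    nlinarith
  · exact h0
  · exfalso
    have hZ : 0 < ‖z‖ ^ 2 - 1 := by nlinarith
    have h4 : ‖1 - conj f * z‖ < ‖z - f‖ :=
      lt_of_pow_lt_pow_left₀ 2 (norm_nonneg _) (by nlinarith [mul_pos hF hZ])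
    have h5 : ‖1 - conj g * z‖ < ‖z - g‖ :=
      lt_of_pow_lt_pow_left₀ 2 (norm_nonneg _) (by nlinarith [mul_pos hG hZ])
    have h6 := mul_lt_mul'' h4 h5 (norm_nonneg _) (norm_nonneg _)
    have h7 : 0 ≤ ‖z - f‖ * ‖z - g‖ := by positivity
    nlinarith

theorem blaschke_deriv_identity {p P f F g G : ℂ} (h₁ : p * P = 1)
    (h₂ : (p - f) * (p - g) = p * (P - F) * (P - G)) :
    (2 * p ^ 2 - p * (f + g + F * G) + P) * ((P - F) * (P - G)) =
      (p - f) * (P - F) * ((p - g) * (P - G)) + (1 - f * F) * ((p - g) * (P - G)) +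
        (1 - g * G) * ((p - f) * (P - F)) := by
  grind

theorem blaschke_value_identity {p P q s f F g G : ℂ} (h₁ : p * P = 1)
    (h₂ : (p - f) * (p - g) = p * (P - F) * (P - G)) (h₃ : p + q + s = f + g + F * G)
    (h₄ : P = q * s) :
    -p * (q + s - f - F * (q * s)) * ((P - F) * (P - G)) =
      (1 - f * F) * ((p - g) * (P - G)) := by
  rw [← h₄]
  linear_combination (-p * ((P - F) * (P - G))) * h₃ + ((P - G) * (p - g)) * h₁
    - F * (P - G) * h₂

theorem unit_conj_identity {p P q Q s S : ℂ} (hp : p * P = 1) (hq : q * Q = 1)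
    (hs : s * S = 1) : P * ((p - q) * (p - s)) = p * (q * s) * ((P - Q) * (P - S)) := by
  grind

theorem blaschke_vertex {f g p q s : ℂ} (hf : ‖f‖ < 1) (hg : ‖g‖ < 1)
    (hp : ‖p‖ = 1) (hq : ‖q‖ = 1) (hs : ‖s‖ = 1)
    (e1 : p + q + s = f + g + conj f * conj g)
    (e2 : p * q + p * s + q * s = f * g + (conj f + conj g)) (e3 : p * q * s = 1) :
    (p - q) * (p - s) ≠ 0 ∧ ∃ (α : ℝ) (η : ℂ),
      (∀ w : ℂ, -p * (q + s - w - conj w * (q * s)) / ((p - q) * (p - s))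
        = ((α + (η * w).re : ℝ) : ℂ)) ∧
      0 < α + (η * f).re ∧ 0 < α + (η * g).re ∧
      (α + (η * f).re) * (α + (η * g).re)
        = (1 - ‖f‖ ^ 2) * (1 - ‖g‖ ^ 2) / 4 * ‖η‖ ^ 2 := by
  have hF : 0 < 1 - ‖f‖ ^ 2 := by nlinarith [norm_nonneg f]
  have hG : 0 < 1 - ‖g‖ ^ 2 := by nlinarith [norm_nonneg g]
  have unit : ∀ {z : ℂ}, ‖z‖ = 1 → z * conj z = 1 := fun {z} hz => by
    rw [Complex.mul_conj']; simp [hz]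
  have hpp := unit hp
  have hqq := unit hq
  have hss := unit hs
  have hpf : p - f ≠ 0 := by
    rw [sub_ne_zero]; rintro rfl; exact hf.ne hp
  have hpg : p - g ≠ 0 := by
    rw [sub_ne_zero]; rintro rfl; exact hg.ne hp
  have hD : 0 < ‖p - f‖ ^ 2 := by positivity
  have hE : 0 < ‖p - g‖ ^ 2 := by positivity
  have hDc : ((‖p - f‖ ^ 2 : ℝ) : ℂ) = (p - f) * (conj p - conj f) := by
    rw [← map_sub, Complex.mul_conj']; simp
  have hEc : ((‖p - g‖ ^ 2 : ℝ) : ℂ) = (p - g) * (conj p - conj g) := by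
    rw [← map_sub, Complex.mul_conj']; simp
  have hFc : ((1 - ‖f‖ ^ 2 : ℝ) : ℂ) = 1 - f * conj f := by
    rw [Complex.mul_conj']; simp
  have hGc : ((1 - ‖g‖ ^ 2 : ℝ) : ℂ) = 1 - g * conj g := by
    rw [Complex.mul_conj']; simp
  have hpf' : conj p - conj f ≠ 0 := by rwa [← map_sub, ne_eq, map_eq_zero]
  have hpg' : conj p - conj g ≠ 0 := by rwa [← map_sub, ne_eq, map_eq_zero]
  generalize hDD : ‖p - f‖ ^ 2 = D at *
  generalize hEE : ‖p - g‖ ^ 2 = E at *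
  generalize hFF : 1 - ‖f‖ ^ 2 = F at *
  generalize hGG : 1 - ‖g‖ ^ 2 = G at *
  set K : ℝ := D * E + F * E + G * D with hK
  have hKpos : 0 < K := by positivity
  have hqs : conj p = q * s := by
    linear_combination (q * s) * hpp - conj p * e3
  have hcub : (p - f) * (p - g) = p * (conj p - conj f) * (conj p - conj g) := by
    grind
  have hder : (p - q) * (p - s) * ((conj p - conj f) * (conj p - conj g)) = (K : ℂ) := by
    rw [hK]; push_cast; rw [hDc, hEc, hFc, hGc]
    have h : (p - q) * (p - s) = 2*p^2 - p*(f+g+conj f*conj g)+conj p := by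
      linear_combination -hqs - p * e1
    rw [h]
    exact blaschke_deriv_identity hpp hcub
  have hne : (p - q) * (p - s) ≠ 0 := by
    intro h; rw [h, zero_mul] at hder
    exact hKpos.ne (by exact_mod_cast hder)
  refine ⟨hne, ?_⟩
  have hconj : conj (p / ((p - q) * (p - s))) = p * (q * s) / ((p - q) * (p - s)) := by
    have hne' : conj ((p - q) * (p - s)) ≠ 0 := by rwa [ne_eq, map_eq_zero]
    rw [map_div₀, div_eq_div_iff hne' hne]
    simp only [map_mul, map_sub]
    exact unit_conj_identity hpp hqq hss
  have hform : ∀ w : ℂ, -p * (q + s - w - conj w * (q * s)) / ((p - q) * (p - s))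
        = (((-p * (q + s) / ((p - q) * (p - s))).re
          + (2 * (p / ((p - q) * (p - s))) * w).re : ℝ) : ℂ) := by
    intro w
    set t := p / ((p - q) * (p - s)) with ht
    have h1 : -p * (q + s - w - conj w * (q * s)) / ((p - q) * (p - s))
        = -(t * (q + s)) + (t * w + conj (t * w)) := by
      rw [map_mul, hconj, ht]; ring
    have h2 : -p * (q + s) / ((p - q) * (p - s)) = -(t * (q + s)) := by rw [ht]; ring
    have h3 : conj (-(t * (q + s))) = -(t * (q + s)) := by
      rw [map_neg, map_mul, hconj, map_add, ht]
      have : (q * s) * (conj q + conj s) = q + s := by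
        linear_combination s * hqq + q * hss
      linear_combination (-p / ((p - q) * (p - s))) * this
    rw [h1, h2, Complex.add_conj]
    push_cast
    rw [Complex.conj_eq_iff_re.1 h3]
    congr 1
    simp [mul_assoc]
  have hvf : -p * (q + s - f - conj f * (q * s)) / ((p - q) * (p - s)) = ((F * E / K : ℝ) : ℂ) := by
    have hK0 : (K : ℂ) ≠ 0 := by exact_mod_cast hKpos.ne'
    push_cast
    rw [div_eq_div_iff hne hK0, ← hder, hFc, hEc]
    have : -p * (q + s - f - conj f * (q * s)) * ((conj p - conj f) * (conj p - conj g))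
      = (1 - f * conj f) * ((p - g) * (conj p - conj g)) :=
      blaschke_value_identity hpp hcub e1 hqs
    linear_combination ((p - q) * (p - s)) * this
  have hvg : -p * (q + s - g - conj g * (q * s)) / ((p - q) * (p - s)) = ((G * D / K : ℝ) : ℂ) := by
    have hK0 : (K : ℂ) ≠ 0 := by exact_mod_cast hKpos.ne'
    push_cast
    rw [div_eq_div_iff hne hK0, ← hder, hGc, hDc]
    have : -p * (q + s - g - conj g * (q * s)) * ((conj p - conj f) * (conj p - conj g))
      = (1 - g * conj g) * ((p - f) * (conj p - conj f)) := by
      rw [mul_comm (conj p - conj f)]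
      exact blaschke_value_identity hpp (by linear_combination hcub) (by linear_combination e1) hqs
    linear_combination ((p - q) * (p - s)) * this
  refine ⟨_, _, hform, ?_⟩
  rw [hform f] at hvf
  rw [hform g] at hvg
  rw [Complex.ofReal_inj.1 hvf, Complex.ofReal_inj.1 hvg]
  refine ⟨by positivity, by positivity, ?_⟩
  have hn : ‖(p - q) * (p - s)‖ ^ 2 * (D * E) = K ^ 2 := by
    have := congrArg (fun z => ‖z‖ ^ 2) hder
    rw [← map_sub, ← map_sub, norm_mul _ (conj (p - f) * conj (p - g)), norm_mul (conj (p - f)),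
      Complex.norm_conj, Complex.norm_conj, mul_pow, mul_pow, hDD, hEE, Complex.norm_real] at this
    rw [this]; simp
  have hnp : 0 < ‖(p - q) * (p - s)‖ ^ 2 := by positivity
  rw [norm_mul, norm_div, hp, mul_pow, div_pow]
  field_simp
  rw [← hn]
  norm_num
  ring

theorem exists_blaschke_triangle {f g : ℂ} (hf : ‖f‖ < 1) (hg : ‖g‖ < 1) :
    ∃ (p : Fin 3 → ℂ) (α : Fin 3 → ℝ) (η : Fin 3 → ℂ), (∀ i, ‖p i‖ = 1) ∧
      (∀ w : ℂ, ∑ i, (α i + (η i * w).re) = 1 ∧ ∑ i, ((α i + (η i * w).re : ℝ) : ℂ) * p i = w) ∧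
      ∀ i, 0 < α i + (η i * f).re ∧ 0 < α i + (η i * g).re ∧
        (α i + (η i * f).re) * (α i + (η i * g).re)
          = (1 - ‖f‖ ^ 2) * (1 - ‖g‖ ^ 2) / 4 * ‖η i‖ ^ 2 := by
  obtain ⟨p, q, s, e1, e2, e3⟩ := exists_three_roots (f + g + conj f * conj g)
    (f * g + (conj f + conj g)) 1
  have hp : ‖p‖ = 1 := norm_eq_one_of_blaschke hf hg (by grind)
  have hq : ‖q‖ = 1 := norm_eq_one_of_blaschke hf hg (by grind)
  have hs : ‖s‖ = 1 := norm_eq_one_of_blaschke hf hg (by grind)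
  obtain ⟨n1, α1, η1, h1, r1⟩ := blaschke_vertex hf hg hp hq hs e1 e2 e3
  obtain ⟨n2, α2, η2, h2, r2⟩ := blaschke_vertex hf hg hq hs hp (by linear_combination e1)
    (by linear_combination e2) (by linear_combination e3)
  obtain ⟨n3, α3, η3, h3, r3⟩ := blaschke_vertex hf hg hs hp hq (by linear_combination e1)
    (by linear_combination e2) (by linear_combination e3)
  have hpq : p - q ≠ 0 := left_ne_zero_of_mul n1
  have hps : p - s ≠ 0 := right_ne_zero_of_mul n1
  have hqs : q - s ≠ 0 := left_ne_zero_of_mul n2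
  refine ⟨![p, q, s], ![α1, α2, α3], ![η1, η2, η3], ?_, fun w => ⟨?_, ?_⟩, ?_⟩
  · simp [Fin.forall_fin_succ, hp, hq, hs]
  · apply Complex.ofReal_injective
    simp only [Fin.sum_univ_three, Matrix.cons_val, Complex.ofReal_add, Complex.ofReal_one] at h1 h2 h3 ⊢
    rw [← h1, ← h2, ← h3, ← neg_sub p q, ← neg_sub p s, ← neg_sub q s]
    field_simp
    grind
  · simp only [Fin.sum_univ_three, Matrix.cons_val]
    rw [← h1, ← h2, ← h3, ← neg_sub p q, ← neg_sub p s, ← neg_sub q s]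
    field_simp
    grind
  · simp only [Fin.forall_fin_succ, Matrix.cons_val_zero, Matrix.cons_val_succ, IsEmpty.forall_iff, and_true]
    exact ⟨r1, r2, r3⟩

/-- Twice the signed area of a planar triangle. -/
def crossDet (x₁ y₁ x₂ y₂ x₃ y₃ : ℝ) : ℝ :=
  (x₂ - x₁) * (y₃ - y₁) - (x₃ - x₁) * (y₂ - y₁)

theorem weights_mul_ge {l₁ l₂ l₃ m₁ m₂ m₃ L₁ L₂ L₃ β : ℝ} (hβ : 0 ≤ β)
    (h₁ : 0 < l₁) (h₂ : 0 < l₂) (h₃ : 0 < l₃) (hL₁ : 0 ≤ L₁) (hL₂ : 0 ≤ L₂) (hL₃ : 0 ≤ L₃)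
    (q₁ : 0 ≤ l₂ ^ 2 * L₃ + l₃ ^ 2 * L₂ + l₂ * l₃ * (L₂ + L₃ - L₁))
    (q₂ : 0 ≤ l₃ ^ 2 * L₁ + l₁ ^ 2 * L₃ + l₃ * l₁ * (L₃ + L₁ - L₂))
    (q₃ : 0 ≤ l₁ ^ 2 * L₂ + l₂ ^ 2 * L₁ + l₁ * l₂ * (L₁ + L₂ - L₃))
    (hm₁ : β * L₁ ≤ l₁ * m₁) (hm₂ : β * L₂ ≤ l₂ * m₂) (hm₃ : β * L₃ ≤ l₃ * m₃) :
    β * (L₁ * L₂ * L₃) * (l₁ + l₂ + l₃) * (m₁ + m₂ + m₃) ≤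
      (l₁ * l₂ * L₃ + l₂ * l₃ * L₁ + l₃ * l₁ * L₂) *
        (m₁ * m₂ * L₃ + m₂ * m₃ * L₁ + m₃ * m₁ * L₂) := by
  obtain ⟨e₁, he₁⟩ : ∃ e, e = l₁ * m₁ - β * L₁ := ⟨_, rfl⟩
  obtain ⟨e₂, he₂⟩ : ∃ e, e = l₂ * m₂ - β * L₂ := ⟨_, rfl⟩
  obtain ⟨e₃, he₃⟩ : ∃ e, e = l₃ * m₃ - β * L₃ := ⟨_, rfl⟩
  have p₁ : 0 ≤ e₁ := by linarith
  have p₂ : 0 ≤ e₂ := by linarith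
  have p₃ : 0 ≤ e₃ := by linarith
  have key : ((l₁ * l₂ * L₃ + l₂ * l₃ * L₁ + l₃ * l₁ * L₂) *
        (m₁ * m₂ * L₃ + m₂ * m₃ * L₁ + m₃ * m₁ * L₂) -
        β * (L₁ * L₂ * L₃) * (l₁ + l₂ + l₃) * (m₁ + m₂ + m₃)) * (l₁ * l₂ * l₃) =
      (l₁ * l₂ * L₃ + l₂ * l₃ * L₁ + l₃ * l₁ * L₂) *
        (e₁ * e₂ * L₃ * l₃ + e₂ * e₃ * L₁ * l₁ + e₃ * e₁ * L₂ * l₂) +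
      β * (e₁ * l₁ * L₂ * L₃ * (l₂ ^ 2 * L₃ + l₃ ^ 2 * L₂ + l₂ * l₃ * (L₂ + L₃ - L₁)) +
        e₂ * l₂ * L₃ * L₁ * (l₃ ^ 2 * L₁ + l₁ ^ 2 * L₃ + l₃ * l₁ * (L₃ + L₁ - L₂)) +
        e₃ * l₃ * L₁ * L₂ * (l₁ ^ 2 * L₂ + l₂ ^ 2 * L₁ + l₁ * l₂ * (L₁ + L₂ - L₃))) := by
    obtain rfl : m₁ = (β * L₁ + e₁) / l₁ := by field_simp; linarith
    obtain rfl : m₂ = (β * L₂ + e₂) / l₂ := by field_simp; linarith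
    obtain rfl : m₃ = (β * L₃ + e₃) / l₃ := by field_simp; linarith
    clear he₁ he₂ he₃
    field_simp
    ring
  rw [← sub_nonneg]
  refine nonneg_of_mul_nonneg_left (b := l₁ * l₂ * l₃) ?_ (by positivity)
  rw [key]
  positivity

theorem affine_foci_mul_ge {a b k c₁ c₂ α η₁ η₂ : ℝ} (ha : 0 < a) (hb : 0 < b)
    (hk : a ^ 2 = b ^ 2 + k ^ 2)
    (h : ∀ x y, (x - c₁) ^ 2 / a ^ 2 + (y - c₂) ^ 2 / b ^ 2 ≤ 1 → 0 ≤ α + η₁ * x + η₂ * y) :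
    0 ≤ α + η₁ * (c₁ - k) + η₂ * c₂ ∧ 0 ≤ α + η₁ * (c₁ + k) + η₂ * c₂ ∧
      b ^ 2 * (η₁ ^ 2 + η₂ ^ 2) ≤
        (α + η₁ * (c₁ - k) + η₂ * c₂) * (α + η₁ * (c₁ + k) + η₂ * c₂) := by
  have hk' : k ^ 2 / a ^ 2 ≤ 1 := by
    rw [div_le_one (by positivity)]; nlinarith
  refine ⟨h _ _ (by simpa using hk'), h _ _ (by simpa using hk'), ?_⟩
  set s := √(a ^ 2 * η₁ ^ 2 + b ^ 2 * η₂ ^ 2) with hs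
  have hs2 : s ^ 2 = a ^ 2 * η₁ ^ 2 + b ^ 2 * η₂ ^ 2 := Real.sq_sqrt (by positivity)
  have hs0 : 0 ≤ s := Real.sqrt_nonneg _
  have hle : s ≤ α + η₁ * c₁ + η₂ * c₂ := by
    rcases hs0.eq_or_lt with h0 | h0
    · rw [← h0]
      exact h _ _ (by simp)
    · have := h (c₁ - a ^ 2 * η₁ / s) (c₂ - b ^ 2 * η₂ / s) (by
        refine le_of_eq ?_
        field_simp
        linear_combination -(a ^ 2 * b ^ 2) * hs2)
      have e : α + η₁ * (c₁ - a ^ 2 * η₁ / s) + η₂ * (c₂ - b ^ 2 * η₂ / s)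
          = α + η₁ * c₁ + η₂ * c₂ - s := by
        field_simp
        linear_combination hs2
      linarith
  have h2 : s ^ 2 ≤ (α + η₁ * c₁ + η₂ * c₂) ^ 2 := by gcongr
  have : (α + η₁ * (c₁ - k) + η₂ * c₂) * (α + η₁ * (c₁ + k) + η₂ * c₂)
      = (α + η₁ * c₁ + η₂ * c₂) ^ 2 - k ^ 2 * η₁ ^ 2 := by ring
  nlinarith

theorem crossDet_foci_mul_ge {a b k c₁ c₂ x₁ y₁ x₂ y₂ x₃ y₃ : ℝ} (ha : 0 < a) (hb : 0 < b)
    (hk : a ^ 2 = b ^ 2 + k ^ 2) (hT : crossDet x₁ y₁ x₂ y₂ x₃ y₃ ≠ 0)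
    (h : ∀ x y, (x - c₁) ^ 2 / a ^ 2 + (y - c₂) ^ 2 / b ^ 2 ≤ 1 → ∃ w₁ w₂ w₃ : ℝ,
      0 ≤ w₁ ∧ w₁ + w₂ + w₃ = 1 ∧ w₁ * x₁ + w₂ * x₂ + w₃ * x₃ = x ∧
      w₁ * y₁ + w₂ * y₂ + w₃ * y₃ = y) :
    let T := crossDet x₁ y₁ x₂ y₂ x₃ y₃
    let l := crossDet (c₁ - k) c₂ x₂ y₂ x₃ y₃ / T
    let m := crossDet (c₁ + k) c₂ x₂ y₂ x₃ y₃ / T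
    let L := (x₂ - x₃) ^ 2 + (y₂ - y₃) ^ 2
    0 < L ∧ 0 < l ∧ b ^ 2 / T ^ 2 * L ≤ l * m := by
  intro T l m L
  change T ≠ 0 at hT
  have key := affine_foci_mul_ge (α := (x₂ * y₃ - x₃ * y₂) / T) (η₁ := (y₂ - y₃) / T)
    (η₂ := (x₃ - x₂) / T) ha hb hk (by
      intro x y hxy
      obtain ⟨w₁, w₂, w₃, h0, h1, hx, hy⟩ := h x y hxy
      have : (x₂ * y₃ - x₃ * y₂) / T + (y₂ - y₃) / T * x + (x₃ - x₂) / T * y = w₁ := by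
        field_simp
        obtain rfl : w₃ = 1 - w₁ - w₂ := by linarith
        rw [← hx, ← hy]
        simp only [T, crossDet]
        ring
      rwa [this])
  have el : (x₂ * y₃ - x₃ * y₂) / T + (y₂ - y₃) / T * (c₁ - k) + (x₃ - x₂) / T * c₂ = l := by
    simp only [l, crossDet]; ring
  have em : (x₂ * y₃ - x₃ * y₂) / T + (y₂ - y₃) / T * (c₁ + k) + (x₃ - x₂) / T * c₂ = m := by
    simp only [m, crossDet]; ring
  have eL : b ^ 2 * (((y₂ - y₃) / T) ^ 2 + ((x₃ - x₂) / T) ^ 2) = b ^ 2 / T ^ 2 * L := by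
    simp only [L]; ring
  rw [el, em, eL] at key
  have hL : 0 < L := by
    by_contra hL
    have hx : x₂ - x₃ = 0 := by nlinarith [sq_nonneg (x₂ - x₃), sq_nonneg (y₂ - y₃)]
    have hy : y₂ - y₃ = 0 := by nlinarith [sq_nonneg (x₂ - x₃), sq_nonneg (y₂ - y₃)]
    apply hT
    simp only [T, crossDet]
    linear_combination (y₃ - y₁) * hx - (x₃ - x₁) * hy
  have hpos : 0 < l * m := lt_of_lt_of_le (by positivity) key.2.2
  exact ⟨hL, lt_of_le_of_ne key.1 fun h0 => by simp [← h0] at hpos, key.2.2⟩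

theorem circumradius_mul_crossDet {S x₁ y₁ x₂ y₂ x₃ y₃ : ℝ} (h₁ : x₁ ^ 2 + y₁ ^ 2 = S)
    (h₂ : x₂ ^ 2 + y₂ ^ 2 = S) (h₃ : x₃ ^ 2 + y₃ ^ 2 = S) :
    ((x₂ - x₃) ^ 2 + (y₂ - y₃) ^ 2) * ((x₃ - x₁) ^ 2 + (y₃ - y₁) ^ 2) *
      ((x₁ - x₂) ^ 2 + (y₁ - y₂) ^ 2) = 4 * S * crossDet x₁ y₁ x₂ y₂ x₃ y₃ ^ 2 := by
  unfold crossDet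
  grind

theorem power_eq_sum {S x₁ y₁ x₂ y₂ x₃ y₃ l₁ l₂ l₃ x y : ℝ} (h₁ : x₁ ^ 2 + y₁ ^ 2 = S)
    (h₂ : x₂ ^ 2 + y₂ ^ 2 = S) (h₃ : x₃ ^ 2 + y₃ ^ 2 = S) (hl : l₁ + l₂ + l₃ = 1)
    (hx : l₁ * x₁ + l₂ * x₂ + l₃ * x₃ = x) (hy : l₁ * y₁ + l₂ * y₂ + l₃ * y₃ = y) :
    l₁ * l₂ * ((x₁ - x₂) ^ 2 + (y₁ - y₂) ^ 2) + l₂ * l₃ * ((x₂ - x₃) ^ 2 + (y₂ - y₃) ^ 2) +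
      l₃ * l₁ * ((x₃ - x₁) ^ 2 + (y₃ - y₁) ^ 2) = S - (x ^ 2 + y ^ 2) := by
  subst hx hy
  obtain rfl : l₃ = 1 - l₁ - l₂ := by linarith
  linear_combination l₁ * h₁ + l₂ * h₂ + (1 - l₁ - l₂) * h₃

theorem four_mul_le_of_triangle {a b k c₁ c₂ S x₁ y₁ x₂ y₂ x₃ y₃ : ℝ} (ha : 0 < a) (hb : 0 < b)
    (hk : a ^ 2 = b ^ 2 + k ^ 2) (hT : crossDet x₁ y₁ x₂ y₂ x₃ y₃ ≠ 0)
    (h₁ : x₁ ^ 2 + y₁ ^ 2 = S) (h₂ : x₂ ^ 2 + y₂ ^ 2 = S) (h₃ : x₃ ^ 2 + y₃ ^ 2 = S)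
    (h : ∀ x y, (x - c₁) ^ 2 / a ^ 2 + (y - c₂) ^ 2 / b ^ 2 ≤ 1 → ∃ w₁ w₂ w₃ : ℝ,
      0 ≤ w₁ ∧ 0 ≤ w₂ ∧ 0 ≤ w₃ ∧ w₁ + w₂ + w₃ = 1 ∧ w₁ * x₁ + w₂ * x₂ + w₃ * x₃ = x ∧
      w₁ * y₁ + w₂ * y₂ + w₃ * y₃ = y) :
    4 * b ^ 2 * S ≤ (S - ((c₁ - k) ^ 2 + c₂ ^ 2)) * (S - ((c₁ + k) ^ 2 + c₂ ^ 2)) := by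
  have r₂ : crossDet x₂ y₂ x₃ y₃ x₁ y₁ = crossDet x₁ y₁ x₂ y₂ x₃ y₃ := by unfold crossDet; ring
  have r₃ : crossDet x₃ y₃ x₁ y₁ x₂ y₂ = crossDet x₁ y₁ x₂ y₂ x₃ y₃ := by unfold crossDet; ring
  obtain ⟨L₁, l₁, M₁⟩ := crossDet_foci_mul_ge ha hb hk hT (fun x y hxy => by
    obtain ⟨w₁, w₂, w₃, p₁, p₂, p₃, s, hx, hy⟩ := h x y hxy
    exact ⟨w₁, w₂, w₃, p₁, s, hx, hy⟩)
  obtain ⟨L₂, l₂, M₂⟩ := crossDet_foci_mul_ge ha hb hk (r₂ ▸ hT) (fun x y hxy => by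
    obtain ⟨w₁, w₂, w₃, p₁, p₂, p₃, s, hx, hy⟩ := h x y hxy
    exact ⟨w₂, w₃, w₁, p₂, by linarith, by linarith, by linarith⟩)
  obtain ⟨L₃, l₃, M₃⟩ := crossDet_foci_mul_ge ha hb hk (r₃ ▸ hT) (fun x y hxy => by
    obtain ⟨w₁, w₂, w₃, p₁, p₂, p₃, s, hx, hy⟩ := h x y hxy
    exact ⟨w₃, w₁, w₂, p₃, by linarith, by linarith, by linarith⟩)
  rw [r₂] at l₂ M₂
  rw [r₃] at l₃ M₃
  have hsum : ∀ x y, crossDet x y x₂ y₂ x₃ y₃ / crossDet x₁ y₁ x₂ y₂ x₃ y₃ +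
      crossDet x y x₃ y₃ x₁ y₁ / crossDet x₁ y₁ x₂ y₂ x₃ y₃ +
      crossDet x y x₁ y₁ x₂ y₂ / crossDet x₁ y₁ x₂ y₂ x₃ y₃ = 1 := by
    intro x y; field_simp; unfold crossDet; ring
  have hpow := fun x y => power_eq_sum h₁ h₂ h₃ (hsum x y) (x := x) (y := y)
    (by field_simp; unfold crossDet; ring) (by field_simp; unfold crossDet; ring)
  have q : ∀ u v x y z w x' y' : ℝ, 0 ≤ u ^ 2 * ((x - z) ^ 2 + (y - w) ^ 2) +
      v ^ 2 * ((x' - x) ^ 2 + (y' - y) ^ 2) + u * v * ((x' - x) ^ 2 + (y' - y) ^ 2 +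
      ((x - z) ^ 2 + (y - w) ^ 2) - ((z - x') ^ 2 + (w - y') ^ 2)) := by
    intro u v x y z w x' y'
    have : 0 ≤ (u * (x - z) - v * (x' - x)) ^ 2 + (u * (y - w) - v * (y' - y)) ^ 2 := by
      positivity
    linarith
  have key := weights_mul_ge (by positivity) l₁ l₂ l₃ L₁.le L₂.le L₃.le
    (q _ _ _ _ _ _ _ _) (q _ _ _ _ _ _ _ _) (q _ _ _ _ _ _ _ _) M₁ M₂ M₃
  rw [hpow, hpow, hsum, hsum, circumradius_mul_crossDet h₁ h₂ h₃] at key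
  refine le_trans (le_of_eq ?_) key
  field_simp

theorem affine_nonneg_on_ellipse {a b k c₁ c₂ α η₁ η₂ x y : ℝ} (ha : 0 < a) (hb : 0 < b)
    (hk : a ^ 2 = b ^ 2 + k ^ 2)
    (hf : 0 ≤ α + η₁ * (c₁ - k) + η₂ * c₂) (hg : 0 ≤ α + η₁ * (c₁ + k) + η₂ * c₂)
    (hfg : b ^ 2 * (η₁ ^ 2 + η₂ ^ 2) ≤
      (α + η₁ * (c₁ - k) + η₂ * c₂) * (α + η₁ * (c₁ + k) + η₂ * c₂))
    (hxy : (x - c₁) ^ 2 / a ^ 2 + (y - c₂) ^ 2 / b ^ 2 ≤ 1) : 0 ≤ α + η₁ * x + η₂ * y := by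
  have h0 : 0 ≤ α + η₁ * c₁ + η₂ * c₂ := by linarith
  have h1 : a ^ 2 * η₁ ^ 2 + b ^ 2 * η₂ ^ 2 ≤ (α + η₁ * c₁ + η₂ * c₂) ^ 2 := by
    rw [hk]; nlinarith
  have h2 : (η₁ * (x - c₁) + η₂ * (y - c₂)) ^ 2 ≤ a ^ 2 * η₁ ^ 2 + b ^ 2 * η₂ ^ 2 := by
    have e : (a ^ 2 * η₁ ^ 2 + b ^ 2 * η₂ ^ 2) *
        ((x - c₁) ^ 2 / a ^ 2 + (y - c₂) ^ 2 / b ^ 2) =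
        (η₁ * (x - c₁) + η₂ * (y - c₂)) ^ 2 +
          (a * η₁ * ((y - c₂) / b) - b * η₂ * ((x - c₁) / a)) ^ 2 := by
      field_simp
      ring
    have := mul_le_mul_of_nonneg_left hxy
      (show 0 ≤ a ^ 2 * η₁ ^ 2 + b ^ 2 * η₂ ^ 2 by positivity)
    nlinarith [sq_nonneg (a * η₁ * ((y - c₂) / b) - b * η₂ * ((x - c₁) / a))]
  have := abs_le_of_sq_le_sq' (h2.trans h1) h0
  linarith [this.1]

theorem focus_lt_of_ellipse_subset {a b k c₁ c₂ S : ℝ} (ha : 0 < a) (hb : 0 < b)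
    (hk : a ^ 2 = b ^ 2 + k ^ 2)
    (h : ∀ x y, (x - c₁) ^ 2 / a ^ 2 + (y - c₂) ^ 2 / b ^ 2 ≤ 1 → x ^ 2 + y ^ 2 ≤ S) :
    (c₁ + k) ^ 2 + c₂ ^ 2 < S := by
  have key : ∀ t : ℝ, t ^ 2 = (b ^ 2 / a) ^ 2 → (c₁ + k) ^ 2 + (c₂ + t) ^ 2 ≤ S := by
    intro t ht
    refine h _ _ (le_of_eq ?_)
    rw [add_sub_cancel_left, add_sub_cancel_left, ht]
    field_simp
    linarith
  have h1 := key (b ^ 2 / a) rfl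
  have h2 := key (-(b ^ 2 / a)) (by ring)
  have : 0 < b ^ 2 / a := by positivity
  nlinarith

theorem exists_triangle_of_four_mul_le {a b k c₁ c₂ r : ℝ} (ha : 0 < a) (hb : 0 < b)
    (hk : a ^ 2 = b ^ 2 + k ^ 2) (hr : 0 < r) (hf : (c₁ - k) ^ 2 + c₂ ^ 2 < r ^ 2)
    (hg : (c₁ + k) ^ 2 + c₂ ^ 2 < r ^ 2)
    (h : 4 * b ^ 2 * r ^ 2 ≤
      (r ^ 2 - ((c₁ - k) ^ 2 + c₂ ^ 2)) * (r ^ 2 - ((c₁ + k) ^ 2 + c₂ ^ 2))) :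
    ∃ X Y : Fin 3 → ℝ, (∀ i, X i ^ 2 + Y i ^ 2 = r ^ 2) ∧
      ∀ x y, (x - c₁) ^ 2 / a ^ 2 + (y - c₂) ^ 2 / b ^ 2 ≤ 1 → ∃ w : Fin 3 → ℝ,
        (∀ i, 0 ≤ w i) ∧ ∑ i, w i = 1 ∧ ∑ i, w i * X i = x ∧ ∑ i, w i * Y i = y := by
  have hnorm : ∀ x y : ℝ, ‖(⟨x / r, y / r⟩ : ℂ)‖ ^ 2 = (x ^ 2 + y ^ 2) / r ^ 2 := by
    intro x y
    rw [← Complex.normSq_eq_norm_sq, Complex.normSq_apply]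
    field_simp
  have hlt : ∀ x y : ℝ, x ^ 2 + y ^ 2 < r ^ 2 → ‖(⟨x / r, y / r⟩ : ℂ)‖ < 1 := by
    intro x y hxy
    rw [← sq_lt_one_iff₀ (norm_nonneg _), hnorm, div_lt_one (by positivity)]
    exact hxy
  obtain ⟨p, α, η, hp, hw, hpos⟩ := exists_blaschke_triangle (hlt _ _ hf) (hlt _ _ hg)
  have hre : ∀ i (x y : ℝ), α i + (η i * ⟨x / r, y / r⟩).re =
      α i + (η i).re / r * x + -(η i).im / r * y := by
    intro i x y
    rw [Complex.mul_re]
    ring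
  refine ⟨fun i => r * (p i).re, fun i => r * (p i).im, fun i => ?_, fun x y hxy =>
    ⟨fun i => α i + (η i * ⟨x / r, y / r⟩).re, fun i => ?_, (hw _).1, ?_, ?_⟩⟩
  · have := congrArg (· ^ 2) (hp i)
    simp only [← Complex.normSq_eq_norm_sq, Complex.normSq_apply] at this
    linear_combination r ^ 2 * this
  · obtain ⟨h1, h2, h3⟩ := hpos i
    rw [hnorm, hnorm, ← Complex.normSq_eq_norm_sq, Complex.normSq_apply] at h3
    rw [hre] at h1 h2
    change 0 ≤ α i + (η i * ⟨x / r, y / r⟩).re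
    rw [hre]
    refine affine_nonneg_on_ellipse ha hb hk h1.le h2.le ?_ hxy
    rw [hre, hre] at h3
    rw [h3]
    have h4 := mul_le_mul_of_nonneg_right h
      (show 0 ≤ ((η i).re * (η i).re + (η i).im * (η i).im) / (4 * r ^ 4) from
        div_nonneg (add_nonneg (mul_self_nonneg _) (mul_self_nonneg _)) (by positivity))
    refine le_trans (le_of_eq ?_) (h4.trans (le_of_eq ?_)) <;> field_simp
  · have := congrArg Complex.re (hw ⟨x / r, y / r⟩).2
    simp only [Complex.re_sum, Complex.re_ofReal_mul] at this
    simp only [mul_left_comm _ r, ← Finset.mul_sum]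
    rw [this]
    field_simp
  · have := congrArg Complex.im (hw ⟨x / r, y / r⟩).2
    simp only [Complex.im_sum, Complex.im_ofReal_mul] at this
    simp only [mul_left_comm _ r, ← Finset.mul_sum]
    rw [this]
    field_simp

theorem coplanar_of_hull_contains_ellipse {a b c₁ c₂ h : ℝ} (ha : 0 < a) (hb : 0 < b)
    {X Y Z : Fin 3 → ℝ}
    (H : ∀ x y, (x - c₁) ^ 2 / a ^ 2 + (y - c₂) ^ 2 / b ^ 2 ≤ 1 → ∃ w : Fin 3 → ℝ,
      (∀ i, 0 ≤ w i) ∧ ∑ i, w i = 1 ∧ ∑ i, w i * X i = x ∧ ∑ i, w i * Y i = y ∧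
      ∑ i, w i * Z i = h) :
    crossDet (X 0) (Y 0) (X 1) (Y 1) (X 2) (Y 2) ≠ 0 ∧ ∀ i, Z i = h := by
  obtain ⟨u, -, u0, u1, u2, u3⟩ := H c₁ c₂ (by simp)
  obtain ⟨v, -, v0, v1, v2, v3⟩ := H (c₁ + a) c₂ (by simp [ha.ne'])
  obtain ⟨w, -, w0, w1, w2, w3⟩ := H c₁ (c₂ + b) (by simp [hb.ne'])
  have hdet : !![X 0, X 1, X 2; Y 0, Y 1, Y 2; 1, 1, 1].det * (Matrix.of ![u, v, w]).det ≠ 0 := by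
    rw [← Matrix.det_transpose (Matrix.of ![u, v, w]), ← Matrix.det_mul]
    have : !![X 0, X 1, X 2; Y 0, Y 1, Y 2; 1, 1, 1] * (Matrix.of ![u, v, w])ᵀ =
        !![c₁, c₁ + a, c₁; c₂, c₂, c₂ + b; 1, 1, 1] := by
      simp only [Fin.sum_univ_three] at *
      ext i j
      fin_cases i <;> fin_cases j <;> simp [Matrix.mul_apply, Fin.sum_univ_three] <;> linarith
    rw [this, Matrix.det_fin_three]
    have hab : a * b ≠ 0 := by positivity
    intro h0
    apply hab
    simp at h0
    linarith
  constructor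
  · intro h0
    apply left_ne_zero_of_mul hdet
    rw [← h0, Matrix.det_fin_three, crossDet]
    simp
    ring
  · have hz : (Matrix.of ![u, v, w]).mulVec (fun i => Z i - h) = 0 := by
      simp only [Fin.sum_univ_three] at *
      ext i
      fin_cases i <;> simp [Matrix.mulVec, dotProduct, Fin.sum_univ_three]
      · linear_combination u3 - h * u0
      · linear_combination v3 - h * v0
      · linear_combination w3 - h * w0
    have := Matrix.eq_zero_of_mulVec_eq_zero (right_ne_zero_of_mul hdet) hz
    intro i
    exact sub_eq_zero.1 (congrFun this i)

theorem inscribed_triangle_iff {a b c₁ c₂ h R : ℝ} (hb : 0 < b) (hab : b ≤ a)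
    (hin : ∀ x y, (x - c₁) ^ 2 / a ^ 2 + (y - c₂) ^ 2 / b ^ 2 ≤ 1 →
      x ^ 2 + y ^ 2 + h ^ 2 ≤ R ^ 2) :
    (∃ X Y Z : Fin 3 → ℝ, (∀ i, X i ^ 2 + Y i ^ 2 + Z i ^ 2 = R ^ 2) ∧
      ∀ x y, (x - c₁) ^ 2 / a ^ 2 + (y - c₂) ^ 2 / b ^ 2 ≤ 1 → ∃ w : Fin 3 → ℝ,
        (∀ i, 0 ≤ w i) ∧ ∑ i, w i = 1 ∧ ∑ i, w i * X i = x ∧ ∑ i, w i * Y i = y ∧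
        ∑ i, w i * Z i = h) ↔
      0 ≤ (R ^ 2 - (c₁ ^ 2 + c₂ ^ 2 + h ^ 2)) ^ 2 -
        2 * (a ^ 2 + b ^ 2) * (R ^ 2 - (c₁ ^ 2 + c₂ ^ 2 + h ^ 2)) + (a ^ 2 - b ^ 2) ^ 2 -
        4 * (a ^ 2 * c₁ ^ 2 + b ^ 2 * c₂ ^ 2) := by
  have ha : 0 < a := hb.trans_le hab
  obtain ⟨k, hk⟩ : ∃ k, a ^ 2 = b ^ 2 + k ^ 2 :=
    ⟨√(a ^ 2 - b ^ 2), by rw [Real.sq_sqrt (by nlinarith)]; ring⟩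
  have e : (R ^ 2 - (c₁ ^ 2 + c₂ ^ 2 + h ^ 2)) ^ 2 -
        2 * (a ^ 2 + b ^ 2) * (R ^ 2 - (c₁ ^ 2 + c₂ ^ 2 + h ^ 2)) + (a ^ 2 - b ^ 2) ^ 2 -
        4 * (a ^ 2 * c₁ ^ 2 + b ^ 2 * c₂ ^ 2) =
      (R ^ 2 - h ^ 2 - ((c₁ - k) ^ 2 + c₂ ^ 2)) * (R ^ 2 - h ^ 2 - ((c₁ + k) ^ 2 + c₂ ^ 2)) -
        4 * b ^ 2 * (R ^ 2 - h ^ 2) := by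
    rw [hk]; ring
  rw [e, sub_nonneg]
  constructor
  · rintro ⟨X, Y, Z, hS, H⟩
    obtain ⟨hT, hZ⟩ := coplanar_of_hull_contains_ellipse ha hb H
    have hXY : ∀ i, X i ^ 2 + Y i ^ 2 = R ^ 2 - h ^ 2 := fun i => by
      linear_combination hS i - (Z i + h) * hZ i
    refine four_mul_le_of_triangle ha hb hk hT (hXY 0) (hXY 1) (hXY 2) fun x y hxy => ?_
    obtain ⟨w, w0, w1, w2, w3, -⟩ := H x y hxy
    simp only [Fin.sum_univ_three] at w1 w2 w3
    exact ⟨w 0, w 1, w 2, w0 0, w0 1, w0 2, w1, w2, w3⟩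
  · intro hle
    have hin' : ∀ x y, (x - c₁) ^ 2 / a ^ 2 + (y - c₂) ^ 2 / b ^ 2 ≤ 1 →
        x ^ 2 + y ^ 2 ≤ R ^ 2 - h ^ 2 := fun x y hxy => by linarith [hin x y hxy]
    have hg := focus_lt_of_ellipse_subset ha hb hk hin'
    have hf := focus_lt_of_ellipse_subset (k := -k) ha hb (by rw [hk]; ring) hin'
    rw [← sub_eq_add_neg] at hf
    have hS : 0 < R ^ 2 - h ^ 2 := lt_of_le_of_lt (by positivity) hg
    obtain ⟨r, hr, hr2⟩ : ∃ r, 0 < r ∧ r ^ 2 = R ^ 2 - h ^ 2 :=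
      ⟨_, Real.sqrt_pos.2 hS, Real.sq_sqrt hS.le⟩
    rw [← hr2] at hf hg hle
    obtain ⟨X, Y, hXY, H⟩ := exists_triangle_of_four_mul_le ha hb hk hr hf hg hle
    refine ⟨X, Y, fun _ => h, fun i => by linarith [hXY i], fun x y hxy => ?_⟩
    obtain ⟨w, w0, w1, w2, w3⟩ := H x y hxy
    exact ⟨w, w0, w1, w2, w3, by rw [← Finset.sum_mul, w1, one_mul]⟩

theorem exists_orthogonal_diagonalization_of_rank_two {Q : Matrix (Fin 3) (Fin 3) ℝ}
    (hQ : Q.PosSemidef) (hr : Q.rank = 2) :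
    ∃ (U : Matrix (Fin 3) (Fin 3) ℝ) (a b : ℝ), 0 < b ∧ b ≤ a ∧ Uᵀ * U = 1 ∧ U * Uᵀ = 1 ∧
      Q = U * diagonal ![a ^ 2, b ^ 2, 0] * Uᵀ := by
  set e := hQ.1.eigenvalues with he
  have hnn : ∀ i, 0 ≤ e i := hQ.eigenvalues_nonneg
  set τ := Tuple.sort e
  have hmono : Monotone (e ∘ τ) := Tuple.monotone_sort e
  have h01 : e (τ 0) ≤ e (τ 1) := hmono (by decide)
  have h12 : e (τ 1) ≤ e (τ 2) := hmono (by decide)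
  have hcard := hQ.1.rank_eq_card_non_zero_eigs
  rw [hr, Fintype.card_subtype, Finset.card_filter, ← Equiv.sum_comp τ, Fin.sum_univ_three,
    ← he] at hcard
  have h0 : e (τ 0) = 0 := by
    by_contra h
    have h' := (hnn (τ 0)).lt_of_ne' h
    rw [if_pos h, if_pos (h'.trans_le h01).ne', if_pos ((h'.trans_le h01).trans_le h12).ne'] at hcard
    omega
  have h1 : 0 < e (τ 1) := by
    refine (hnn _).lt_of_ne' fun h => ?_
    rw [if_neg (not_not.2 h0), if_neg (not_not.2 h)] at hcard
    split_ifs at hcard <;> omega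
  let σ : Equiv.Perm (Fin 3) := Fin.revPerm.trans τ
  let W : Matrix (Fin 3) (Fin 3) ℝ := hQ.1.eigenvectorUnitary
  have hW : W * Wᵀ = 1 := Unitary.coe_mul_star_self hQ.1.eigenvectorUnitary
  have hW' : Wᵀ * W = 1 := Unitary.coe_star_mul_self hQ.1.eigenvectorUnitary
  refine ⟨W.submatrix id σ, √(e (τ 2)), √(e (τ 1)), Real.sqrt_pos.2 h1, Real.sqrt_le_sqrt h12,
    ?_, ?_, ?_⟩
  · rw [transpose_submatrix, ← submatrix_mul _ _ _ id _ Function.bijective_id, hW',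
      submatrix_one_equiv]
  · rw [transpose_submatrix, submatrix_mul_equiv, hW, submatrix_id_id]
  · have hd : diagonal ![√(e (τ 2)) ^ 2, √(e (τ 1)) ^ 2, 0] = (diagonal e).submatrix σ σ := by
      rw [submatrix_diagonal_equiv, Real.sq_sqrt (hnn _), Real.sq_sqrt (hnn _), ← h0]
      congr 1
      ext i
      fin_cases i <;> rfl
    rw [hd, transpose_submatrix, submatrix_mul_equiv, submatrix_mul_equiv, submatrix_id_id]
    exact hQ.1.spectral_theorem

theorem mem_convexHull_range_iff {ι V : Type*} [Fintype ι] [AddCommGroup V] [Module ℝ V]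
    {p : ι → V} {x : V} :
    x ∈ convexHull ℝ (Set.range p) ↔
      ∃ w : ι → ℝ, (∀ i, 0 ≤ w i) ∧ ∑ i, w i = 1 ∧ ∑ i, w i • p i = x := by
  constructor
  · intro hx
    have : convexHull ℝ (Set.range p) ⊆ (Fintype.linearCombination ℝ p) '' stdSimplex ℝ ι := by
      classical
      refine convexHull_min ?_ ((convex_stdSimplex ℝ ι).linear_image _)
      rintro _ ⟨i, rfl⟩
      exact ⟨Pi.single i 1, single_mem_stdSimplex ℝ i, by simp [Fintype.linearCombination_apply_single]⟩
    obtain ⟨w, hw, rfl⟩ := this hx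
    exact ⟨w, hw.1, hw.2, rfl⟩
  · rintro ⟨w, h0, h1, rfl⟩
    exact (convex_convexHull ℝ _).sum_mem (fun i _ => h0 i) h1
      fun i _ => subset_convexHull ℝ _ ⟨i, rfl⟩

section Coordinates

variable {U Q P : Matrix (Fin 3) (Fin 3) ℝ} {a b : ℝ}

theorem transpose_mulVec_dotProduct (hU : U * Uᵀ = 1) (y z : Fin 3 → ℝ) :
    (Uᵀ *ᵥ y) ⬝ᵥ (Uᵀ *ᵥ z) = y ⬝ᵥ z := by
  rw [dotProduct_mulVec, vecMul_transpose, mulVec_mulVec, hU, one_mulVec]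

theorem norm_sq_eq_transpose_mulVec (hU : U * Uᵀ = 1) (x : EuclideanSpace ℝ (Fin 3)) :
    ‖x‖ ^ 2 = (Uᵀ *ᵥ x.ofLp) 0 ^ 2 + (Uᵀ *ᵥ x.ofLp) 1 ^ 2 + (Uᵀ *ᵥ x.ofLp) 2 ^ 2 := by
  have h := transpose_mulVec_dotProduct hU x.ofLp x.ofLp
  rw [dotProduct, dotProduct, Fin.sum_univ_three, Fin.sum_univ_three] at h
  rw [EuclideanSpace.norm_sq_eq, Fin.sum_univ_three]
  simp only [Real.norm_eq_abs, sq_abs]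
  linear_combination -h

theorem dotProduct_mulVec_diagonalization (hQ : Q = U * diagonal ![a ^ 2, b ^ 2, 0] * Uᵀ)
    (y : Fin 3 → ℝ) :
    y ⬝ᵥ Q *ᵥ y = a ^ 2 * (Uᵀ *ᵥ y) 0 ^ 2 + b ^ 2 * (Uᵀ *ᵥ y) 1 ^ 2 := by
  rw [hQ, ← mulVec_mulVec, ← mulVec_mulVec, dotProduct_mulVec, ← mulVec_transpose, dotProduct,
    Fin.sum_univ_three, mulVec_diagonal, mulVec_diagonal, mulVec_diagonal]
  simp
  ring

theorem mem_range_and_pseudoinverse_le_iff (ha : 0 < a) (hb : 0 < b) (hU : U * Uᵀ = 1)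
    (hU' : Uᵀ * U = 1) (hQ : Q = U * diagonal ![a ^ 2, b ^ 2, 0] * Uᵀ) (hP : Q * P * Q = Q)
    (y : Fin 3 → ℝ) :
    ((∃ w, y = Q *ᵥ w) ∧ y ⬝ᵥ P *ᵥ y ≤ 1) ↔
      (Uᵀ *ᵥ y) 2 = 0 ∧ (Uᵀ *ᵥ y) 0 ^ 2 / a ^ 2 + (Uᵀ *ᵥ y) 1 ^ 2 / b ^ 2 ≤ 1 := by
  have hT : Qᵀ = Q := by
    rw [hQ, transpose_mul, transpose_mul, transpose_transpose, diagonal_transpose, Matrix.mul_assoc]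
  have hUQ : ∀ w, Uᵀ *ᵥ Q *ᵥ w = diagonal ![a ^ 2, b ^ 2, 0] *ᵥ Uᵀ *ᵥ w := fun w => by
    rw [hQ, ← mulVec_mulVec, ← mulVec_mulVec, mulVec_mulVec _ Uᵀ U, hU', one_mulVec]
  have hval : ∀ w, (Q *ᵥ w) ⬝ᵥ P *ᵥ Q *ᵥ w = (Uᵀ *ᵥ Q *ᵥ w) 0 ^ 2 / a ^ 2 +
      (Uᵀ *ᵥ Q *ᵥ w) 1 ^ 2 / b ^ 2 := fun w => by
    have hw : (Q *ᵥ w) ⬝ᵥ P *ᵥ Q *ᵥ w = w ⬝ᵥ Q *ᵥ w := by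
      nth_rw 1 [← hT]
      rw [mulVec_transpose, ← dotProduct_mulVec, mulVec_mulVec, mulVec_mulVec, hP]
    rw [hw, hUQ, mulVec_diagonal, mulVec_diagonal, dotProduct_mulVec_diagonalization hQ]
    simp
    field_simp
  constructor
  · rintro ⟨⟨w, rfl⟩, hw⟩
    rw [hval] at hw
    refine ⟨?_, hw⟩
    rw [hUQ, mulVec_diagonal]
    simp
  · rintro ⟨h2, hle⟩
    have hy : y = Q *ᵥ U *ᵥ ![(Uᵀ *ᵥ y) 0 / a ^ 2, (Uᵀ *ᵥ y) 1 / b ^ 2, 0] := by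
      have : Uᵀ *ᵥ y =
          Uᵀ *ᵥ Q *ᵥ U *ᵥ ![(Uᵀ *ᵥ y) 0 / a ^ 2, (Uᵀ *ᵥ y) 1 / b ^ 2, 0] := by
        rw [hUQ, mulVec_mulVec _ Uᵀ U, hU', one_mulVec]
        ext i
        rw [mulVec_diagonal]
        fin_cases i
        · simp; field_simp
        · simp; field_simp
        · simpa using h2
      simpa only [mulVec_mulVec _ U Uᵀ, hU, one_mulVec] using congrArg (U *ᵥ ·) this
    refine ⟨⟨_, hy⟩, ?_⟩
    have := hval (U *ᵥ ![(Uᵀ *ᵥ y) 0 / a ^ 2, (Uᵀ *ᵥ y) 1 / b ^ 2, 0])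
    rw [← hy] at this
    rwa [this]

theorem trace_eq_of_diagonalization (hU' : Uᵀ * U = 1)
    (hQ : Q = U * diagonal ![a ^ 2, b ^ 2, 0] * Uᵀ) : Q.trace = a ^ 2 + b ^ 2 := by
  rw [hQ, trace_mul_comm, ← Matrix.mul_assoc, hU', Matrix.one_mul, trace_diagonal,
    Fin.sum_univ_three]
  simp

theorem trace_sq_eq_of_diagonalization (hU' : Uᵀ * U = 1)
    (hQ : Q = U * diagonal ![a ^ 2, b ^ 2, 0] * Uᵀ) : (Q * Q).trace = a ^ 4 + b ^ 4 := by
  have : Q * Q = U * diagonal ![(a ^ 2) ^ 2, (b ^ 2) ^ 2, 0] * Uᵀ := by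
    rw [hQ, show U * diagonal ![a ^ 2, b ^ 2, 0] * Uᵀ * (U * diagonal ![a ^ 2, b ^ 2, 0] * Uᵀ) =
      U * diagonal ![a ^ 2, b ^ 2, 0] * (Uᵀ * U) * diagonal ![a ^ 2, b ^ 2, 0] * Uᵀ by
        simp only [Matrix.mul_assoc], hU', Matrix.mul_one, Matrix.mul_assoc U, diagonal_mul_diagonal]
    congr 3
    ext i
    fin_cases i <;> simp [sq]
  rw [trace_eq_of_diagonalization hU' this]
  ring

theorem det_eq_zero_of_diagonalization (hQ : Q = U * diagonal ![a ^ 2, b ^ 2, 0] * Uᵀ) :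
    Q.det = 0 := by
  rw [hQ, det_mul, det_mul, det_diagonal, Fin.prod_univ_three]
  simp

end Coordinates

/-- **Nested triangle criterion for a degenerate ellipsoid (filled ellipse) in a sphere.**
Let `Q` be a real symmetric positive semidefinite 3×3 matrix of rank 2, with
Moore–Penrose pseudoinverse `P = Q⁺`, and let `E = {c + v : v ∈ range Q, vᵀ Q⁺ v ≤ 1}`
be the corresponding filled ellipse with centre `c`, contained in the closed ball of
radius `R > 0` about the origin.  With `d = ‖c‖`,
`u = R² − tr Q + 2 d̂ᵀ Q d̂` (the skew term taken to be `0` when `d = 0`) and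
`q = R⁴ − 2R² tr Q − 8R √(det Q) + 2 tr(Q²) − (tr Q)²` (here `det Q = 0`),
a triangle with all three vertices on the sphere of radius `R` contains `E`
iff `d⁴ − 2u d² + q ≥ 0`. -/
theorem nested_triangle_degenerate_ellipsoid_in_sphere
    (Q P : Matrix (Fin 3) (Fin 3) ℝ) (hQsymm : Q.IsSymm) (hQpsd : Q.PosSemidef)
    (hQrank : Q.rank = 2) (hP : IsMoorePenroseInv Q P)
    (c : EuclideanSpace ℝ (Fin 3)) (R : ℝ) (hR : 0 < R)
    (E : Set (EuclideanSpace ℝ (Fin 3)))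
    (hE : E = {x | (∃ w : Fin 3 → ℝ, (fun i => x i - c i) = Q.mulVec w) ∧
      (fun i => x i - c i) ⬝ᵥ P.mulVec (fun i => x i - c i) ≤ 1})
    (hEB : E ⊆ Metric.closedBall 0 R)
    (d u q : ℝ)
    (hd : d = ‖c‖)
    (hu : u = R ^ 2 - Q.trace +
      (if d = 0 then 0
       else 2 * ((fun i => c i / d) ⬝ᵥ Q.mulVec (fun i => c i / d))))
    (hq : q = R ^ 4 - 2 * R ^ 2 * Q.trace - 8 * R * Real.sqrt Q.det
      + 2 * (Q * Q).trace - Q.trace ^ 2) :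
    (∃ p : Fin 3 → EuclideanSpace ℝ (Fin 3),
        (∀ i, p i ∈ Metric.sphere (0 : EuclideanSpace ℝ (Fin 3)) R) ∧
        E ⊆ convexHull ℝ (Set.range p)) ↔
      d ^ 4 - 2 * u * d ^ 2 + q ≥ 0 := by
  obtain ⟨U, a, b, hb, hab, hU', hU, hQ⟩ := exists_orthogonal_diagonalization_of_rank_two hQpsd hQrank
  have ha : 0 < a := hb.trans_le hab
  set C := Uᵀ *ᵥ c.ofLp with hC
  have hcoord : ∀ v : Fin 3 → ℝ, Uᵀ *ᵥ U *ᵥ v = v := fun v => by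
    rw [mulVec_mulVec, hU', one_mulVec]
  have hmem : ∀ x, x ∈ E ↔ (Uᵀ *ᵥ x.ofLp) 2 = C 2 ∧
      ((Uᵀ *ᵥ x.ofLp) 0 - C 0) ^ 2 / a ^ 2 + ((Uᵀ *ᵥ x.ofLp) 1 - C 1) ^ 2 / b ^ 2 ≤ 1 := fun x => by
    rw [hE]
    refine (mem_range_and_pseudoinverse_le_iff ha hb hU hU' hQ hP.1 (x.ofLp - c.ofLp)).trans ?_
    rw [mulVec_sub, ← hC, Pi.sub_apply, Pi.sub_apply, Pi.sub_apply, sub_eq_zero]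
  have hin : ∀ x y, (x - C 0) ^ 2 / a ^ 2 + (y - C 1) ^ 2 / b ^ 2 ≤ 1 →
      x ^ 2 + y ^ 2 + C 2 ^ 2 ≤ R ^ 2 := fun x y hxy => by
    have hx : WithLp.toLp 2 (U *ᵥ ![x, y, C 2]) ∈ E := by
      rw [hmem, hcoord]
      exact ⟨rfl, hxy⟩
    have := pow_le_pow_left₀ (norm_nonneg _) (mem_closedBall_zero_iff.1 (hEB hx)) 2
    rw [norm_sq_eq_transpose_mulVec hU, hcoord] at this
    exact this
  have hd2 : d ^ 2 = C 0 ^ 2 + C 1 ^ 2 + C 2 ^ 2 := by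
    rw [hd, norm_sq_eq_transpose_mulVec hU]
  have hskew : (if d = 0 then 0
      else 2 * ((fun i => c i / d) ⬝ᵥ Q.mulVec (fun i => c i / d))) * d ^ 2 =
      2 * (a ^ 2 * C 0 ^ 2 + b ^ 2 * C 1 ^ 2) := by
    split_ifs with h0
    · have hC0 : C = 0 := by
        rw [hC, (norm_eq_zero.1 (hd.symm.trans h0) : c = 0), WithLp.ofLp_zero, mulVec_zero]
      rw [hC0]
      simp
    · have : (fun i => c i / d) = d⁻¹ • c.ofLp := by
        ext i
        simp [div_eq_inv_mul]
      rw [this, mulVec_smul, smul_dotProduct, dotProduct_smul,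
        dotProduct_mulVec_diagonalization hQ, ← hC]
      simp only [smul_eq_mul]
      field_simp
  have hval : d ^ 4 - 2 * u * d ^ 2 + q =
      (R ^ 2 - (C 0 ^ 2 + C 1 ^ 2 + C 2 ^ 2)) ^ 2 -
        2 * (a ^ 2 + b ^ 2) * (R ^ 2 - (C 0 ^ 2 + C 1 ^ 2 + C 2 ^ 2)) + (a ^ 2 - b ^ 2) ^ 2 -
        4 * (a ^ 2 * C 0 ^ 2 + b ^ 2 * C 1 ^ 2) := by
    rw [hq, hu, trace_sq_eq_of_diagonalization hU' hQ, trace_eq_of_diagonalization hU' hQ,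
      det_eq_zero_of_diagonalization hQ, Real.sqrt_zero, ← hd2]
    linear_combination -2 * hskew
  rw [ge_iff_le, hval, ← inscribed_triangle_iff hb hab hin]
  constructor
  · rintro ⟨p, hp, hsub⟩
    refine ⟨fun i => (Uᵀ *ᵥ (p i).ofLp) 0, fun i => (Uᵀ *ᵥ (p i).ofLp) 1,
      fun i => (Uᵀ *ᵥ (p i).ofLp) 2, fun i => ?_, fun x y hxy => ?_⟩
    · rw [← norm_sq_eq_transpose_mulVec hU, mem_sphere_zero_iff_norm.1 (hp i)]
    · have hx : WithLp.toLp 2 (U *ᵥ ![x, y, C 2]) ∈ E := by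
        rw [hmem, hcoord]
        exact ⟨rfl, hxy⟩
      obtain ⟨w, w0, w1, hw⟩ := mem_convexHull_range_iff.1 (hsub hx)
      have hw' : ∑ i, w i • (Uᵀ *ᵥ (p i).ofLp) = ![x, y, C 2] := by
        have := congrArg (fun z => Uᵀ *ᵥ WithLp.ofLp z) hw
        simpa only [WithLp.ofLp_sum, WithLp.ofLp_smul, mulVec_sum, mulVec_smul, hcoord] using this
      refine ⟨w, w0, w1, ?_, ?_, ?_⟩
      · simpa using congrFun hw' 0
      · simpa using congrFun hw' 1
      · simpa using congrFun hw' 2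
  · rintro ⟨X, Y, Z, hS, H⟩
    refine ⟨fun i => WithLp.toLp 2 (U *ᵥ ![X i, Y i, Z i]), fun i => ?_, fun x hx => ?_⟩
    · rw [mem_sphere_zero_iff_norm, ← sq_eq_sq₀ (norm_nonneg _) hR.le,
        norm_sq_eq_transpose_mulVec hU, hcoord]
      exact hS i
    · obtain ⟨h2, hxy⟩ := (hmem x).1 hx
      obtain ⟨w, w0, w1, wX, wY, wZ⟩ := H _ _ hxy
      refine mem_convexHull_range_iff.2 ⟨w, w0, w1, ?_⟩
      have hw : ∑ i, w i • ![X i, Y i, Z i] = Uᵀ *ᵥ x.ofLp := by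
        ext j
        fin_cases j
        · simpa using wX
        · simpa using wY
        · simpa using wZ.trans h2.symm
      apply WithLp.ofLp_injective 2
      rw [WithLp.ofLp_sum]
      simp only [WithLp.ofLp_smul, ← mulVec_smul, ← mulVec_sum]
      rw [hw, mulVec_mulVec, hU, one_mulVec]
end

section
/- (Grace–Danielsson inequality.) Let E be a closed ball of radius r > 0 in ℝ³ whose centre is at distance d from the origin, and let B be the sphere of radius R > 0 centred at the origin, with E contained in the closed ball bounded by B (i.e. d + r ≤ R). Then there exists a tetrahedron (the convex hull of four points each lying on the sphere B) containing E if and only if d² ≤ (R + r)(R − 3r). -/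
/-- Light-cone estimate: if `q` lies on the sphere of radius `R` and the affine function with
value `a` at the centre and linear part `l` is nonnegative on a ball of radius `r`, then pairing it
with the Lorentz image of `q` is nonnegative. -/
lemma lorentz_pairing_nonneg {R r s a q₀ q₁ q₂ l₀ l₁ l₂ : ℝ} (hR : 0 < R)
    (hq : q₀ ^ 2 + q₁ ^ 2 + q₂ ^ 2 = R ^ 2)
    (h : ∀ N y₀ y₁ y₂ : ℝ, 0 ≤ N → y₀ ^ 2 + y₁ ^ 2 + y₂ ^ 2 = N ^ 2 →
      0 ≤ N * a - r * (y₀ * l₀ + y₁ * l₁ + y₂ * l₂)) :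
    0 ≤ ((1 + s ^ 2) * R - (1 - s ^ 2) * q₀) * a
      - r * (((1 + s ^ 2) * q₀ - (1 - s ^ 2) * R) * l₀ + 2 * s * q₁ * l₁ + 2 * s * q₂ * l₂) := by
  apply h
  · have h₁ : q₀ ≤ R := abs_le_of_sq_le_sq' (by nlinarith [sq_nonneg q₁, sq_nonneg q₂]) hR.le |>.2
    have h₂ : -R ≤ q₀ := abs_le_of_sq_le_sq' (by nlinarith [sq_nonneg q₁, sq_nonneg q₂]) hR.le |>.1
    nlinarith [mul_nonneg (sq_nonneg s) (by linarith : 0 ≤ R + q₀)]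
  · linear_combination 4 * s ^ 2 * hq

/-- The sum over the vertices of a tetrahedron of the estimates `lorentz_pairing_nonneg`. -/
lemma quadratic_nonneg_of_barycentric {ι : Type*} [Fintype ι] {R r d : ℝ} (hR : 0 < R)
    {α : ι → ℝ} {P L : ι → Fin 3 → ℝ}
    (hP : ∀ i, P i 0 ^ 2 + P i 1 ^ 2 + P i 2 ^ 2 = R ^ 2)
    (hα : ∑ i, α i = 1) (hαP : ∑ i, α i * P i 0 = d)
    (hL : ∑ i, L i 0 = 0) (hLP : ∀ j, ∑ i, L i j * P i j = 1)
    (h : ∀ i, ∀ N y₀ y₁ y₂ : ℝ, 0 ≤ N → y₀ ^ 2 + y₁ ^ 2 + y₂ ^ 2 = N ^ 2 →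
      0 ≤ N * α i - r * (y₀ * L i 0 + y₁ * L i 1 + y₂ * L i 2)) (s : ℝ) :
    0 ≤ (R - r + d) * (s * s) + (-4 * r) * s + (R - r - d) := by
  have key := Finset.sum_nonneg fun i (_ : i ∈ Finset.univ) ↦
    lorentz_pairing_nonneg (s := s) hR (hP i) (h i)
  have expand : ∑ i, (((1 + s ^ 2) * R - (1 - s ^ 2) * P i 0) * α i
      - r * (((1 + s ^ 2) * P i 0 - (1 - s ^ 2) * R) * L i 0 + 2 * s * P i 1 * L i 1
        + 2 * s * P i 2 * L i 2)) =
      (1 + s ^ 2) * R * ∑ i, α i - (1 - s ^ 2) * ∑ i, α i * P i 0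
      - r * ((1 + s ^ 2) * ∑ i, L i 0 * P i 0 - (1 - s ^ 2) * R * ∑ i, L i 0
        + 2 * s * ∑ i, L i 1 * P i 1 + 2 * s * ∑ i, L i 2 * P i 2) := by
    simp only [Finset.mul_sum, ← Finset.sum_add_distrib, ← Finset.sum_sub_distrib]
    exact Finset.sum_congr rfl fun i _ ↦ by ring
  rw [expand, hα, hαP, hL, hLP, hLP, hLP] at key
  linarith

section

variable {E : Type*} [NormedAddCommGroup E] [InnerProductSpace ℝ E]

/-- Every vector of a three-dimensional space is a nonnegative multiple of the first vector of some
orthonormal basis. -/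
lemma exists_orthonormalBasis_eq_norm_smul (hE : Module.finrank ℝ E = 3) (c : E) :
    ∃ b : OrthonormalBasis (Fin 3) ℝ E, c = ‖c‖ • b 0 := by
  have : FiniteDimensional ℝ E := .of_finrank_pos (by omega)
  have : Nontrivial E := Module.nontrivial_of_finrank_pos (R := ℝ) (by omega)
  obtain ⟨e, he, hce⟩ : ∃ e : E, ‖e‖ = 1 ∧ c = ‖c‖ • e := by
    rcases eq_or_ne c 0 with rfl | hc
    · obtain ⟨e, he⟩ := exists_norm_eq E zero_le_one
      exact ⟨e, he, by simp⟩
    · refine ⟨‖c‖⁻¹ • c, ?_, ?_⟩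
      · rw [norm_smul, norm_inv, norm_norm, inv_mul_cancel₀ (norm_ne_zero_iff.2 hc)]
      · rw [smul_smul, mul_inv_cancel₀ (norm_ne_zero_iff.2 hc), one_smul]
  have hv : Orthonormal ℝ (({0} : Set (Fin 3)).domRestrict fun _ ↦ e) :=
    ⟨fun _ ↦ he, fun i j hij ↦ absurd (Subsingleton.elim i j) hij⟩
  obtain ⟨b, hb⟩ := hv.exists_orthonormalBasis_extension_of_card_eq (by simpa using hE)
  exact ⟨b, by rw [hb 0 rfl]; exact hce⟩

lemma OrthonormalBasis.norm_sq_eq_fin_three (b : OrthonormalBasis (Fin 3) ℝ E) (x : E) :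
    ‖x‖ ^ 2 = b.repr x 0 ^ 2 + b.repr x 1 ^ 2 + b.repr x 2 ^ 2 := by
  rw [← b.repr.norm_map, EuclideanSpace.norm_sq_eq]
  simp [Fin.sum_univ_three]

/-- Necessity in the Grace–Danielsson inequality. -/
lemma sq_le_of_closedBall_subset_convexHull (b : OrthonormalBasis (Fin 3) ℝ E) {r R d : ℝ}
    (hr : 0 < r) (hR : 0 < R) {p : Fin 4 → E} (hp : ∀ i, ‖p i‖ = R)
    (h : Metric.closedBall (d • b 0) r ⊆ convexHull ℝ (Set.range p)) :
    d ^ 2 ≤ (R + r) * (R - 3 * r) := by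
  have : FiniteDimensional ℝ E := b.toBasis.finiteDimensional_of_finite
  have hfin : Module.finrank ℝ E = 3 := by simpa using Module.finrank_eq_card_basis b.toBasis
  have hspan : affineSpan ℝ (Set.range p) = ⊤ :=
    interior_convexHull_nonempty_iff_affineSpan_eq_top.1
      ⟨d • b 0, mem_interior_iff_mem_nhds.2
        (Filter.mem_of_superset (Metric.closedBall_mem_nhds _ hr) h)⟩
  have hind : AffineIndependent ℝ p := by
    rw [affineIndependent_iff_finrank_vectorSpan_eq (n := 3) ℝ p (by simp),
      ← direction_affineSpan, hspan, AffineSubspace.direction_top, finrank_top, hfin]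
  let B : AffineBasis (Fin 4) ℝ E := ⟨p, hind, hspan⟩
  have hB : ∀ i, B i = p i := fun _ ↦ rfl
  have hadd : ∀ i x y, B.coord i (x + y) = B.coord i x + (B.coord i).linear y := fun i x y ↦ by
    have := (B.coord i).map_vadd x y
    rw [vadd_eq_add, vadd_eq_add, add_comm y] at this
    rw [this, add_comm]
  have hlin : ∀ i y, (B.coord i).linear y = B.coord i y - B.coord i 0 := fun i y ↦ by
    rw [← zero_add y, hadd, zero_add]; ring
  have hnonneg : ∀ i, ∀ y : E, ‖y‖ ≤ r → 0 ≤ B.coord i (d • b 0) + (B.coord i).linear y := by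
    intro i y hy
    have hmem := h (show d • b 0 + y ∈ Metric.closedBall (d • b 0) r by simpa using hy)
    have hmem' : d • b 0 + y ∈ convexHull ℝ (Set.range B) := hmem
    rw [B.convexHull_eq_nonneg_coord] at hmem'
    rw [← hadd]
    exact hmem' i
  have hrepr : ∀ x j, ∑ i, B.coord i x * b.repr (p i) j = b.repr x j := fun x j ↦ by
    have := congrArg (fun v ↦ b.repr v j) (B.linear_combination_coord_eq_self x)
    simpa [hB] using this
  have key := quadratic_nonneg_of_barycentric (ι := Fin 4) (r := r) (d := d) hR
    (α := fun i ↦ B.coord i (d • b 0)) (P := fun i j ↦ b.repr (p i) j)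
    (L := fun i j ↦ (B.coord i).linear (b j))
    (fun i ↦ by rw [← b.norm_sq_eq_fin_three, hp]) (B.sum_coord_apply_eq_one _)
    (by rw [hrepr]; simp)
    (by simp only [hlin, Finset.sum_sub_distrib, B.sum_coord_apply_eq_one, sub_self])
    (fun j ↦ by
      simp only [hlin, sub_mul, Finset.sum_sub_distrib, hrepr]
      simp)
    (fun i N y₀ y₁ y₂ hN hy ↦ by
      rcases hN.eq_or_lt with rfl | hN
      · have h₀ : y₀ = 0 := by nlinarith [sq_nonneg y₀, sq_nonneg y₁, sq_nonneg y₂]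
        have h₁ : y₁ = 0 := by nlinarith [sq_nonneg y₀, sq_nonneg y₁, sq_nonneg y₂]
        have h₂ : y₂ = 0 := by nlinarith [sq_nonneg y₀, sq_nonneg y₁, sq_nonneg y₂]
        simp [h₀, h₁, h₂]
      · set y : E := y₀ • b 0 + y₁ • b 1 + y₂ • b 2 with hy_def
        have hyN : ‖y‖ = N := by
          rw [← sq_eq_sq₀ (norm_nonneg _) hN.le, b.norm_sq_eq_fin_three, ← hy]
          simp [hy_def]
        have := hnonneg i (-(r / N) • y) (by
          rw [norm_smul, hyN, norm_neg, Real.norm_of_nonneg (by positivity)]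
          exact (div_mul_cancel₀ r hN.ne').le)
        have hly : (B.coord i).linear y = y₀ * (B.coord i).linear (b 0)
            + y₁ * (B.coord i).linear (b 1) + y₂ * (B.coord i).linear (b 2) := by
          simp only [hy_def, map_add, (B.coord i).linear.map_smul, smul_eq_mul]
        rw [(B.coord i).linear.map_smul, hly, smul_eq_mul] at this
        have hNr : N * (r / N) = r := mul_div_cancel₀ r hN.ne'
        linear_combination mul_nonneg hN.le this - hNr * (y₀ * (B.coord i).linear (b 0)
          + y₁ * (B.coord i).linear (b 1) + y₂ * (B.coord i).linear (b 2)))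
  have := discrim_le_zero key
  rw [discrim] at this
  nlinarith

/-- The barycentric coordinates of a point of the ball with respect to a base vertex of the regular
pyramid are nonnegative. -/
lemma base_coord_nonneg {r m ρ H y₀ y₁ y₂ u v : ℝ} (hρ : 0 < ρ) (hH : 0 < H) (hm : 0 ≤ m)
    (hy : y₀ ^ 2 + y₁ ^ 2 + y₂ ^ 2 ≤ r ^ 2) (huv : u ^ 2 + v ^ 2 = 1)
    (h : r ^ 2 * (ρ ^ 2 + 4 * H ^ 2) ≤ (m * ρ) ^ 2) :
    0 ≤ (m - y₀) / (3 * H) + 2 / (3 * ρ) * (y₁ * u + y₂ * v) := by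
  have hcs : (y₁ * u + y₂ * v) ^ 2 ≤ y₁ ^ 2 + y₂ ^ 2 := by
    have : (y₁ * u + y₂ * v) ^ 2 + (y₁ * v - y₂ * u) ^ 2 = y₁ ^ 2 + y₂ ^ 2 := by
      linear_combination (y₁ ^ 2 + y₂ ^ 2) * huv
    nlinarith [sq_nonneg (y₁ * v - y₂ * u)]
  have hle : ρ * y₀ - 2 * H * (y₁ * u + y₂ * v) ≤ m * ρ := by
    refine abs_le_of_sq_le_sq' ?_ (by positivity) |>.2
    refine le_trans ?_ h
    have hsq := sq_nonneg (2 * H * y₀ + ρ * (y₁ * u + y₂ * v))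
    have : (y₀ ^ 2 + (y₁ * u + y₂ * v) ^ 2) * (ρ ^ 2 + 4 * H ^ 2) ≤ r ^ 2 * (ρ ^ 2 + 4 * H ^ 2) :=
      mul_le_mul_of_nonneg_right (by linarith) (by positivity)
    linarith
  have : (m - y₀) / (3 * H) + 2 / (3 * ρ) * (y₁ * u + y₂ * v) =
      (m * ρ - (ρ * y₀ - 2 * H * (y₁ * u + y₂ * v))) / (3 * H * ρ) := by
    field_simp
    ring
  rw [this]
  exact div_nonneg (by linarith) (by positivity)

/-- Sufficiency in the Grace–Danielsson inequality: the regular pyramid with apex `R • b 0` whose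
base touches the ball works. -/
lemma exists_closedBall_subset_convexHull (b : OrthonormalBasis (Fin 3) ℝ E) {r R d : ℝ}
    (hr : 0 < r) (hd : 0 ≤ d) (hdR : d + r ≤ R) (h : d ^ 2 ≤ (R + r) * (R - 3 * r)) :
    ∃ p : Fin 4 → E, (∀ i, ‖p i‖ = R) ∧
      Metric.closedBall (d • b 0) r ⊆ convexHull ℝ (Set.range p) := by
  have hlt : 0 < R - r - d := by
    rcases hdR.eq_or_lt with h' | h'
    · nlinarith
    · linarith
  obtain ⟨t, ht⟩ : ∃ t : ℝ, t ^ 2 = 3 := ⟨√3, Real.sq_sqrt (by norm_num)⟩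
  have hρ₂ : 0 < R ^ 2 - (d - r) ^ 2 := by
    have : 0 < (R - r + d) * (R + r - d) := mul_pos (by linarith) (by linarith)
    linarith
  obtain ⟨ρ, hρ, hρ_sq⟩ : ∃ ρ : ℝ, 0 < ρ ∧ ρ ^ 2 = R ^ 2 - (d - r) ^ 2 :=
    ⟨_, Real.sqrt_pos.2 hρ₂, Real.sq_sqrt hρ₂.le⟩
  have hH : 0 < R - d + r := by linarith
  have hcond : r ^ 2 * (ρ ^ 2 + 4 * (R - d + r) ^ 2) ≤ ((R - d) * ρ) ^ 2 := by
    rw [mul_pow, hρ_sq]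
    have : 0 ≤ (R - d + r) ^ 2 * ((R + r) * (R - 3 * r) - d ^ 2) :=
      mul_nonneg (sq_nonneg _) (by linarith)
    linarith
  refine ⟨![R • b 0, (d - r) • b 0 + ρ • b 1,
    (d - r) • b 0 + (-(ρ / 2)) • b 1 + (t * ρ / 2) • b 2,
    (d - r) • b 0 + (-(ρ / 2)) • b 1 + (-(t * ρ / 2)) • b 2], ?_, ?_⟩
  · intro i
    rw [← sq_eq_sq₀ (norm_nonneg _) (by linarith), b.norm_sq_eq_fin_three]
    fin_cases i <;> simp
    · linarith
    · linear_combination hρ_sq + ρ ^ 2 / 4 * ht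
    · linear_combination hρ_sq + ρ ^ 2 / 4 * ht
  · intro x hx
    obtain ⟨y, rfl⟩ : ∃ y, x = d • b 0 + y := ⟨x - d • b 0, by abel⟩
    have hy : ‖y‖ ≤ r := by simpa using hx
    have hy_sq := (b.norm_sq_eq_fin_three y).symm.trans_le (pow_le_pow_left₀ (norm_nonneg _) hy 2)
    set y₀ := b.repr y 0
    set y₁ := b.repr y 1
    set y₂ := b.repr y 2
    have hy₀ : -r ≤ y₀ :=
      (abs_le_of_sq_le_sq' (by nlinarith [sq_nonneg y₁, sq_nonneg y₂]) hr.le).1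
    have base {u v : ℝ} (huv : u ^ 2 + v ^ 2 = 1) :=
      base_coord_nonneg hρ hH (by linarith : 0 ≤ R - d) hy_sq huv hcond
    let w (u v : ℝ) : ℝ := (R - d - y₀) / (3 * (R - d + r)) + 2 / (3 * ρ) * (y₁ * u + y₂ * v)
    refine mem_convexHull_of_exists_fintype
      ![(y₀ + r) / (R - d + r), w 1 0, w (-(1 / 2)) (t / 2), w (-(1 / 2)) (-(t / 2))]
      _ ?_ ?_ (fun i ↦ Set.mem_range_self i) ?_
    · intro i
      fin_cases i
      · exact div_nonneg (by linarith) hH.le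
      · exact base (by norm_num)
      · exact base (by linear_combination ht / 4)
      · exact base (by linear_combination ht / 4)
    · simp only [Fin.sum_univ_four, w, Matrix.cons_val]
      field_simp
      ring
    · apply b.repr.injective
      ext j
      fin_cases j <;> simp [Fin.sum_univ_four, w]
      · change _ = d + y₀
        field_simp
        ring
      · change _ = y₁
        field_simp
        ring
      · change _ = y₂
        field_simp
        linear_combination 2 * (R - d + r) * y₂ * ht

end

/-- **Grace–Danielsson inequality.**
Let `E` be the closed ball of radius `r > 0` centred at `c ∈ ℝ³` with `d = ‖c‖`,
and let `B` be the sphere of radius `R > 0` about the origin, with `E` contained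
in the closed ball bounded by `B` (i.e. `d + r ≤ R`).  Then a tetrahedron with all
four vertices on `B` contains `E` iff `d² ≤ (R + r)(R − 3r)`. -/
theorem grace_danielsson_nested_tetrahedron
    (c : EuclideanSpace ℝ (Fin 3)) (r R d : ℝ) (hr : 0 < r) (hR : 0 < R)
    (hd : d = ‖c‖) (hcontained : d + r ≤ R) :
    (∃ p : Fin 4 → EuclideanSpace ℝ (Fin 3),
        (∀ i, p i ∈ Metric.sphere (0 : EuclideanSpace ℝ (Fin 3)) R) ∧
        Metric.closedBall c r ⊆ convexHull ℝ (Set.range p)) ↔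
      d ^ 2 ≤ (R + r) * (R - 3 * r) := by
  obtain ⟨b, hb⟩ := exists_orthonormalBasis_eq_norm_smul (by simp) c
  rw [← hd] at hb
  simp only [mem_sphere_zero_iff_norm]
  rw [hb]
  constructor
  · rintro ⟨p, hp, h⟩
    exact sq_le_of_closedBall_subset_convexHull b hr hR hp h
  · exact exists_closedBall_subset_convexHull b hr (hd ▸ norm_nonneg c) hcontained
end

section
/- Let s₁, s₂, s₃ > 0 and let E be the solid ellipsoid in ℝ³ with semiaxes s₁, s₂, s₃ and centre c = (d, 0, 0) with d ≥ 0, whose s₁-axis points along the first coordinate direction, i.e. E = {x ∈ ℝ³ : ((x₁ − d)/s₁)² + (x₂/s₂)² + (x₃/s₃)² ≤ 1}. Let B be the sphere of radius R > 0 centred at the origin, and suppose E is contained in the closed ball bounded by B. Then there exists a tetrahedron (the convex hull of four points each lying on the sphere B) containing E if and only if d² ≤ (R − s₁)² − (s₂ + s₃)². -/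
open Finset in
/-- The arithmetic core of the necessity direction: a Cauchy–Schwarz estimate for a tensor that is
a sum of products of vectors in the forward cone of `ℝ × ℝ³`. -/
theorem sq_le_of_sum_cone_products {ι : Type*} [Fintype ι] {s₁ σ d R : ℝ} (hσ : 0 ≤ σ)
    (a u₁ u₂ u₃ p₁ p₂ p₃ : ι → ℝ) (hR : 0 ≤ R) (ha : ∀ i, 0 ≤ a i)
    (hau : ∀ i, u₁ i ^ 2 + u₂ i ^ 2 + u₃ i ^ 2 ≤ a i ^ 2)
    (hp : ∀ i, p₁ i ^ 2 + p₂ i ^ 2 + p₃ i ^ 2 = R ^ 2)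
    (h_one : ∑ i, a i = 1) (h_zero : ∑ i, u₁ i = 0) (h_centre : ∑ i, a i * p₁ i = d)
    (h_first : ∑ i, u₁ i * p₁ i = s₁) (h_rest : ∑ i, (u₂ i * p₂ i + u₃ i * p₃ i) = σ) :
    d ^ 2 ≤ (R - s₁) ^ 2 - σ ^ 2 := by
  have hX : ∑ i, (a i - u₁ i) * (R + p₁ i) = R + d - s₁ := by
    have : ∀ i, (a i - u₁ i) * (R + p₁ i) = a i * R + a i * p₁ i - u₁ i * R - u₁ i * p₁ i := by
      intro i; ring
    simp only [this, sum_sub_distrib, sum_add_distrib, ← sum_mul, h_one, h_zero, h_centre, h_first]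
    ring
  have hY : ∑ i, (a i + u₁ i) * (R - p₁ i) = R - d - s₁ := by
    have : ∀ i, (a i + u₁ i) * (R - p₁ i) = a i * R - a i * p₁ i + u₁ i * R - u₁ i * p₁ i := by
      intro i; ring
    simp only [this, sum_sub_distrib, sum_add_distrib, ← sum_mul, h_one, h_zero, h_centre, h_first]
    ring
  have hu : ∀ i, |u₁ i| ≤ a i := fun i =>
    abs_le_of_sq_le_sq (by nlinarith [hau i, sq_nonneg (u₂ i), sq_nonneg (u₃ i)]) (ha i)
  have hp' : ∀ i, |p₁ i| ≤ R := fun i =>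
    abs_le_of_sq_le_sq (by nlinarith [hp i, sq_nonneg (p₂ i), sq_nonneg (p₃ i)]) hR
  have hX0 : ∀ i, 0 ≤ (a i - u₁ i) * (R + p₁ i) := fun i =>
    mul_nonneg (by linarith [(abs_le.1 (hu i)).2]) (by linarith [(abs_le.1 (hp' i)).1])
  have hY0 : ∀ i, 0 ≤ (a i + u₁ i) * (R - p₁ i) := fun i =>
    mul_nonneg (by linarith [(abs_le.1 (hu i)).1]) (by linarith [(abs_le.1 (hp' i)).2])
  have hterm : ∀ i, u₂ i * p₂ i + u₃ i * p₃ i ≤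
      √((a i - u₁ i) * (R + p₁ i)) * √((a i + u₁ i) * (R - p₁ i)) := by
    intro i
    rw [← Real.sqrt_mul (hX0 i)]
    apply Real.le_sqrt_of_sq_le
    have hv : 0 ≤ a i ^ 2 - u₁ i ^ 2 - (u₂ i ^ 2 + u₃ i ^ 2) := by linarith [hau i]
    have hw : 0 ≤ p₂ i ^ 2 + p₃ i ^ 2 := by positivity
    have hq : R ^ 2 - p₁ i ^ 2 = p₂ i ^ 2 + p₃ i ^ 2 := by linarith [hp i]
    calc (u₂ i * p₂ i + u₃ i * p₃ i) ^ 2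
        ≤ (u₂ i ^ 2 + u₃ i ^ 2) * (p₂ i ^ 2 + p₃ i ^ 2) := by
          nlinarith [sq_nonneg (u₂ i * p₃ i - u₃ i * p₂ i)]
      _ ≤ (a i ^ 2 - u₁ i ^ 2) * (p₂ i ^ 2 + p₃ i ^ 2) := by nlinarith [mul_nonneg hv hw]
      _ = _ := by rw [← hq]; ring
  have hsum : σ ≤ √(R + d - s₁) * √(R - d - s₁) := by
    rw [← h_rest, ← hX, ← hY]
    exact (sum_le_sum fun i _ => hterm i).trans
      (Real.sum_sqrt_mul_sqrt_le _ hX0 hY0)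
  have hX1 : 0 ≤ R + d - s₁ := hX ▸ sum_nonneg fun i _ => hX0 i
  have hY1 : 0 ≤ R - d - s₁ := hY ▸ sum_nonneg fun i _ => hY0 i
  have hsq := pow_le_pow_left₀ hσ hsum 2
  rw [mul_pow, Real.sq_sqrt hX1, Real.sq_sqrt hY1] at hsq
  nlinarith

/-- A linear form on the unit disc whose constant term dominates its gradient is nonnegative. -/
theorem add_mul_add_mul_nonneg {A B C y z : ℝ} (hA : 0 ≤ A) (h : B ^ 2 + C ^ 2 ≤ A ^ 2)
    (hyz : y ^ 2 + z ^ 2 ≤ 1) : 0 ≤ A + B * y + C * z := by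
  have h1 : (B * y + C * z) ^ 2 ≤ A ^ 2 := by
    have h2 : (B * y + C * z) ^ 2 ≤ (B ^ 2 + C ^ 2) * (y ^ 2 + z ^ 2) := by
      nlinarith [sq_nonneg (B * z - C * y)]
    have h3 : (B ^ 2 + C ^ 2) * (y ^ 2 + z ^ 2) ≤ (B ^ 2 + C ^ 2) * 1 :=
      mul_le_mul_of_nonneg_left hyz (by positivity)
    linarith
  linarith [(abs_le.1 (abs_le_of_sq_le_sq h1 hA)).1]

/-- Existence of the heights of the two horizontal edges of the optimal tetrahedron. -/
theorem exists_edge_heights {s₁ s₂ s₃ d R : ℝ} (hs₁ : 0 < s₁) (hs₂ : 0 < s₂) (hs₃ : 0 < s₃)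
    (hd : 0 ≤ d) (hR : s₁ + d < R) (hσ : (s₂ + s₃) ^ 2 = (R - s₁) ^ 2 - d ^ 2) :
    ∃ h h' : ℝ, h' < h ∧ h ^ 2 < R ^ 2 ∧ h' ^ 2 < R ^ 2 ∧ 0 ≤ d - h' ∧ 0 ≤ h - d ∧
      ((d - h') ^ 2 - s₁ ^ 2) * (R ^ 2 - h ^ 2) = (s₂ * (h - h')) ^ 2 ∧
      ((h - d) ^ 2 - s₁ ^ 2) * (R ^ 2 - h' ^ 2) = (s₃ * (h - h')) ^ 2 := by
  have hR0 : 0 < R := by linarith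
  obtain ⟨m, hm0, hm⟩ : ∃ m : ℝ, 0 ≤ m ∧ m ^ 2 = R * s₁ * (R * s₁ + s₂ * s₃) :=
    ⟨√(R * s₁ * (R * s₁ + s₂ * s₃)), Real.sqrt_nonneg _, Real.sq_sqrt (by positivity)⟩
  have hmR : R * s₁ ≤ m := by
    apply le_of_sq_le_sq _ hm0
    have : 0 < R * s₁ * (s₂ * s₃) := by positivity
    nlinarith
  have hP : 0 < s₂ * R + s₁ * s₃ := by positivity
  have hP' : 0 < s₃ * R + s₁ * s₂ := by positivity
  obtain ⟨h, hh⟩ : ∃ h, (s₂ * R + s₁ * s₃) * h = s₂ * d * R + (s₂ + s₃) * m :=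
    ⟨_, mul_div_cancel₀ _ hP.ne'⟩
  obtain ⟨h', hh'⟩ : ∃ h', (s₃ * R + s₁ * s₂) * h' = s₃ * d * R - (s₂ + s₃) * m :=
    ⟨_, mul_div_cancel₀ _ hP'.ne'⟩
  have hσm : (s₂ + s₃) * (R * s₁) ≤ (s₂ + s₃) * m := by gcongr
  have hC : s₁ ≤ h - d := by
    refine le_of_mul_le_mul_left ?_ hP
    have : 0 ≤ s₁ * s₃ * (R - s₁ - d) := mul_nonneg (by positivity) (by linarith)
    nlinarith
  have hA : s₁ ≤ d - h' := by
    refine le_of_mul_le_mul_left ?_ hP'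
    have : 0 ≤ s₁ * s₂ * (R - s₁ + d) := mul_nonneg (by positivity) (by linarith)
    nlinarith
  have hD : 0 < h - h' := by linarith
  have e₁ : (s₂ + s₃) * ((d - h') * R - s₁ * h) = s₂ * (R - s₁) * (h - h') := by
    linear_combination -hh - hh'
  have e₂ : (s₂ + s₃) * ((d - h') * h - s₁ * R) = s₂ * d * (h - h') := by
    apply mul_left_cancel₀ (mul_pos hP hP').ne'
    linear_combination s₃ * d * (s₃ * R + s₁ * s₂) * hh + s₂ * d * (s₂ * R + s₁ * s₃) * hh'
      - (s₂ + s₃) * ((s₃ * R + s₁ * s₂) * h' * hh + (s₂ * d * R + (s₂ + s₃) * m) * hh')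
      + (s₂ + s₃) ^ 3 * hm + (s₂ + s₃) * R * s₁ * s₂ * s₃ * hσ
  have hσ0 : 0 < s₂ + s₃ := by positivity
  have f₁ : (s₂ + s₃) * ((d - h' - s₁) * (R + h)) = s₂ * (R - s₁ + d) * (h - h') := by
    linear_combination e₁ + e₂
  have f₂ : (s₂ + s₃) * ((d - h' + s₁) * (R - h)) = s₂ * (R - s₁ - d) * (h - h') := by
    linear_combination e₁ - e₂
  have f₃ : (s₂ + s₃) * ((h - d + s₁) * (R + h')) = s₃ * (R - s₁ + d) * (h - h') := by
    linear_combination -f₁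
  have f₄ : (s₂ + s₃) * ((h - d - s₁) * (R - h')) = s₃ * (R - s₁ - d) * (h - h') := by
    linear_combination -f₂
  have hlt : 0 < R - h := by
    have : 0 < (s₂ + s₃) * ((d - h' + s₁) * (R - h)) := by
      rw [f₂]; exact mul_pos (mul_pos hs₂ (by linarith)) hD
    exact pos_of_mul_pos_right (pos_of_mul_pos_right this hσ0.le) (by linarith)
  have hlt' : 0 < R + h' := by
    have : 0 < (s₂ + s₃) * ((h - d + s₁) * (R + h')) := by
      rw [f₃]; exact mul_pos (mul_pos hs₃ (by linarith)) hD
    exact pos_of_mul_pos_right (pos_of_mul_pos_right this hσ0.le) (by linarith)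
  have hσ2 : (s₂ + s₃) ^ 2 ≠ 0 := by positivity
  refine ⟨h, h', by linarith, sq_lt_sq' (by linarith) (by linarith),
    sq_lt_sq' (by linarith) (by linarith), by linarith, by linarith, ?_, ?_⟩
  · apply mul_left_cancel₀ hσ2
    linear_combination (s₂ + s₃) * ((d - h' + s₁) * (R - h)) * f₁
      + s₂ * (R - s₁ + d) * (h - h') * f₂ - (s₂ * (h - h')) ^ 2 * hσ
  · apply mul_left_cancel₀ hσ2
    linear_combination (s₂ + s₃) * ((h - d - s₁) * (R - h')) * f₃
      + s₃ * (R - s₁ + d) * (h - h') * f₄ - (s₃ * (h - h')) ^ 2 * hσ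

/-- The nonnegativity on the ellipsoid of an affine form coming from a pair of opposite edges. -/
theorem edge_weight_nonneg {A D k s t y z : ℝ} (hA : 0 ≤ A) (hD : 0 < D) (hk : k ≠ 0)
    (hs : s ≠ 0) (ht : t ≠ 0) (h : (A ^ 2 - s ^ 2) * k ^ 2 = (t * D) ^ 2)
    (hyz : (y / s) ^ 2 + (z / t) ^ 2 ≤ 1) : 0 ≤ ((A + y) / D + z / k) / 2 := by
  have h1 : s ^ 2 + (D * t / k) ^ 2 ≤ A ^ 2 := by
    have : (D * t / k) ^ 2 = A ^ 2 - s ^ 2 := by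
      rw [div_pow, div_eq_iff (by positivity), h]; ring
    linarith
  have h2 := add_mul_add_mul_nonneg hA h1 hyz
  have h3 : ((A + y) / D + z / k) / 2 = (A + s * (y / s) + D * t / k * (z / t)) / (2 * D) := by
    field_simp
  rw [h3]
  positivity

/-- Four points with affine weights at a point with coordinates `x`, the points forming two
horizontal edges in the coordinate planes. -/
theorem mem_convexHull_two_edges {h h' k k' : ℝ} (hD : h' ≠ h) (hk : k ≠ 0) (hk' : k' ≠ 0)
    (x : EuclideanSpace ℝ (Fin 3))
    (h₀ : 0 ≤ ((x 0 - h') / (h - h') + x 1 / k) / 2)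
    (h₁ : 0 ≤ ((x 0 - h') / (h - h') - x 1 / k) / 2)
    (h₂ : 0 ≤ ((h - x 0) / (h - h') + x 2 / k') / 2)
    (h₃ : 0 ≤ ((h - x 0) / (h - h') - x 2 / k') / 2) :
    x ∈ convexHull ℝ (Set.range
      (![!₂[h, k, 0], !₂[h, -k, 0], !₂[h', 0, k'], !₂[h', 0, -k']] :
        Fin 4 → EuclideanSpace ℝ (Fin 3))) := by
  have hD' : h - h' ≠ 0 := sub_ne_zero.2 hD.symm
  set p : Fin 4 → EuclideanSpace ℝ (Fin 3) :=
    ![!₂[h, k, 0], !₂[h, -k, 0], !₂[h', 0, k'], !₂[h', 0, -k']] with hp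
  let w : Fin 4 → ℝ := ![((x 0 - h') / (h - h') + x 1 / k) / 2,
    ((x 0 - h') / (h - h') - x 1 / k) / 2, ((h - x 0) / (h - h') + x 2 / k') / 2,
    ((h - x 0) / (h - h') - x 2 / k') / 2]
  have hx : x = ∑ i, w i • p i := by
    ext j
    fin_cases j <;> simp [Fin.sum_univ_four, w, hp] <;> field_simp <;> ring
  rw [hx]
  refine (convex_convexHull ℝ _).sum_mem (fun i _ => ?_) ?_
    fun i _ => subset_convexHull ℝ _ (Set.mem_range_self i)
  · fin_cases i <;> assumption
  · simp only [Fin.sum_univ_four, w]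
    simp
    field_simp
    ring

/-- The first vertex of an aligned ellipsoid bounds the radius of an enclosing centred ball. -/
theorem add_le_of_ellipsoid_subset_closedBall {s₁ s₂ s₃ d R : ℝ} (hs₁ : 0 < s₁)
    (hEB : {x : EuclideanSpace ℝ (Fin 3) |
      ((x 0 - d) / s₁) ^ 2 + (x 1 / s₂) ^ 2 + (x 2 / s₃) ^ 2 ≤ 1} ⊆ Metric.closedBall 0 R) :
    s₁ + d ≤ R := by
  have h : (!₂[s₁ + d, 0, 0] : EuclideanSpace ℝ (Fin 3)) ∈ Metric.closedBall 0 R := by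
    apply hEB
    simp [hs₁.ne']
  rw [mem_closedBall_zero_iff, EuclideanSpace.norm_eq] at h
  simp only [Fin.sum_univ_three] at h
  simp [Real.sqrt_sq_eq_abs] at h
  exact (le_abs_self _).trans h

/-- Sufficiency: an inscribed tetrahedron around the ellipsoid, from the optimal one around the
ellipsoid stretched along its first axis. -/
theorem exists_tetrahedron_of_sq_le {s₁ s₂ s₃ d R : ℝ} (hs₁ : 0 < s₁) (hs₂ : 0 < s₂)
    (hs₃ : 0 < s₃) (hd : 0 ≤ d) (hdR : s₁ + d ≤ R)
    (hcond : d ^ 2 ≤ (R - s₁) ^ 2 - (s₂ + s₃) ^ 2) :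
    ∃ p : Fin 4 → EuclideanSpace ℝ (Fin 3),
      (∀ i, p i ∈ Metric.sphere (0 : EuclideanSpace ℝ (Fin 3)) R) ∧
      {x : EuclideanSpace ℝ (Fin 3) |
        ((x 0 - d) / s₁) ^ 2 + (x 1 / s₂) ^ 2 + (x 2 / s₃) ^ 2 ≤ 1} ⊆
        convexHull ℝ (Set.range p) := by
  have hR0 : 0 < R := by linarith
  obtain ⟨q, hq0, hq⟩ : ∃ q : ℝ, 0 ≤ q ∧ q ^ 2 = d ^ 2 + (s₂ + s₃) ^ 2 :=
    ⟨√(d ^ 2 + (s₂ + s₃) ^ 2), Real.sqrt_nonneg _, Real.sq_sqrt (by positivity)⟩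
  have hqR : q ≤ R - s₁ := le_of_sq_le_sq (by linarith) (by linarith)
  have hdq : d < q := lt_of_pow_lt_pow_left₀ 2 hq0 (by rw [hq]; nlinarith [mul_pos hs₂ hs₃])
  have hs : s₁ ≤ R - q := by linarith
  obtain ⟨h, h', hlt, hhR, hhR', hA, hC, e, e'⟩ :=
    exists_edge_heights (s₁ := R - q) (by linarith) hs₂ hs₃ hd (by linarith)
      (by linarith : (s₂ + s₃) ^ 2 = (R - (R - q)) ^ 2 - d ^ 2)
  obtain ⟨k, hk0, hk⟩ : ∃ k : ℝ, k ≠ 0 ∧ k ^ 2 = R ^ 2 - h ^ 2 :=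
    ⟨√(R ^ 2 - h ^ 2), (Real.sqrt_pos.2 (by linarith)).ne', Real.sq_sqrt (by linarith)⟩
  obtain ⟨k', hk0', hk'⟩ : ∃ k : ℝ, k ≠ 0 ∧ k ^ 2 = R ^ 2 - h' ^ 2 :=
    ⟨√(R ^ 2 - h' ^ 2), (Real.sqrt_pos.2 (by linarith)).ne', Real.sq_sqrt (by linarith)⟩
  rw [← hk] at e
  rw [← hk'] at e'
  have hsph : h ^ 2 + k ^ 2 = R ^ 2 := by linarith
  have hsph' : h' ^ 2 + k' ^ 2 = R ^ 2 := by linarith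
  refine ⟨_, ?_, fun x hx => mem_convexHull_two_edges hlt.ne hk0 hk0' x ?_ ?_ ?_ ?_⟩
  · intro i
    rw [mem_sphere_zero_iff_norm, EuclideanSpace.norm_eq, Fin.sum_univ_three]
    fin_cases i <;> simp [hsph, hsph', Real.sqrt_sq hR0.le]
  all_goals
    have hstretch : ((x 0 - d) / (R - q)) ^ 2 ≤ ((x 0 - d) / s₁) ^ 2 := by
      rw [div_pow, div_pow]
      gcongr
    have hx' : ((x 0 - d) / s₁) ^ 2 + (x 1 / s₂) ^ 2 + (x 2 / s₃) ^ 2 ≤ 1 := hx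
    have hD : 0 < h - h' := by linarith
    have hs₁' : R - q ≠ 0 := by linarith
    have hneg : ∀ a b : ℝ, (-a / b) ^ 2 = (a / b) ^ 2 := fun a b => by ring
  · have := edge_weight_nonneg (y := x 0 - d) (z := x 1) hA hD hk0 hs₁' hs₂.ne' e
      (by linarith [sq_nonneg (x 2 / s₃)])
    convert this using 4
    ring
  · have := edge_weight_nonneg (y := x 0 - d) (z := -x 1) hA hD hk0 hs₁' hs₂.ne' e
      (by linarith [hneg (x 1) s₂, sq_nonneg (x 2 / s₃)])
    convert this using 2
    ring
  · have := edge_weight_nonneg (y := -(x 0 - d)) (z := x 2) hC hD hk0' hs₁' hs₃.ne' e'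
      (by linarith [hneg (x 0 - d) (R - q), sq_nonneg (x 1 / s₂)])
    convert this using 4
    ring
  · have := edge_weight_nonneg (y := -(x 0 - d)) (z := -x 2) hC hD hk0' hs₁' hs₃.ne' e'
      (by linarith [hneg (x 0 - d) (R - q), hneg (x 2) s₃, sq_nonneg (x 1 / s₂)])
    convert this using 2
    ring

/-- A point of an ellipsoid, parametrized by the closed unit ball. -/
theorem ellipsoid_param_mem {s₁ s₂ s₃ d a b c : ℝ} (hs₁ : 0 < s₁) (hs₂ : 0 < s₂) (hs₃ : 0 < s₃)
    (h : a ^ 2 + b ^ 2 + c ^ 2 ≤ 1) :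
    (!₂[d + s₁ * a, s₂ * b, s₃ * c] : EuclideanSpace ℝ (Fin 3)) ∈
      {x : EuclideanSpace ℝ (Fin 3) |
        ((x 0 - d) / s₁) ^ 2 + (x 1 / s₂) ^ 2 + (x 2 / s₃) ^ 2 ≤ 1} := by
  have e₁ : s₁ * a / s₁ = a := by field_simp
  have e₂ : s₂ * b / s₂ = b := by field_simp
  have e₃ : s₃ * c / s₃ = c := by field_simp
  simpa [e₁, e₂, e₃] using h

/-- Four points whose convex hull contains an ellipsoid form an affine basis. -/
theorem affineIndependent_of_ellipsoid_subset {s₁ s₂ s₃ d : ℝ}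
    (p : Fin 4 → EuclideanSpace ℝ (Fin 3))
    (hsub : {x : EuclideanSpace ℝ (Fin 3) |
      ((x 0 - d) / s₁) ^ 2 + (x 1 / s₂) ^ 2 + (x 2 / s₃) ^ 2 ≤ 1} ⊆ convexHull ℝ (Set.range p)) :
    AffineIndependent ℝ p ∧ affineSpan ℝ (Set.range p) = ⊤ := by
  have hint : (interior (convexHull ℝ (Set.range p))).Nonempty := by
    refine ⟨!₂[d, 0, 0], ?_⟩
    have hopen : IsOpen {x : EuclideanSpace ℝ (Fin 3) |
        ((x 0 - d) / s₁) ^ 2 + (x 1 / s₂) ^ 2 + (x 2 / s₃) ^ 2 < 1} :=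
      isOpen_lt (by fun_prop) continuous_const
    refine interior_maximal ?_ hopen ?_
    · exact fun x hx => hsub (le_of_lt (show _ < (1 : ℝ) from hx))
    · simp
  have hspan : affineSpan ℝ (Set.range p) = ⊤ :=
    interior_convexHull_nonempty_iff_affineSpan_eq_top.1 hint
  refine ⟨?_, hspan⟩
  rw [affineIndependent_iff_finrank_vectorSpan_eq ℝ p (n := 3) (by simp),
    ← direction_affineSpan, hspan, AffineSubspace.direction_top]
  simp

/-- Necessity: barycentric coordinates are affine forms that are nonnegative on the ellipsoid. -/
theorem sq_le_of_ellipsoid_subset_tetrahedron {s₁ s₂ s₃ d R : ℝ} (hs₁ : 0 < s₁) (hs₂ : 0 < s₂)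
    (hs₃ : 0 < s₃) (hR : 0 ≤ R) (p : Fin 4 → EuclideanSpace ℝ (Fin 3))
    (hp : ∀ i, p i ∈ Metric.sphere (0 : EuclideanSpace ℝ (Fin 3)) R)
    (hsub : {x : EuclideanSpace ℝ (Fin 3) |
      ((x 0 - d) / s₁) ^ 2 + (x 1 / s₂) ^ 2 + (x 2 / s₃) ^ 2 ≤ 1} ⊆ convexHull ℝ (Set.range p)) :
    d ^ 2 ≤ (R - s₁) ^ 2 - (s₂ + s₃) ^ 2 := by
  obtain ⟨hind, hspan⟩ := affineIndependent_of_ellipsoid_subset p hsub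
  let B : AffineBasis (Fin 4) ℝ (EuclideanSpace ℝ (Fin 3)) := ⟨p, hind, hspan⟩
  let ctr : EuclideanSpace ℝ (Fin 3) := !₂[d, 0, 0]
  let e₁ : EuclideanSpace ℝ (Fin 3) := !₂[s₁, 0, 0]
  let e₂ : EuclideanSpace ℝ (Fin 3) := !₂[0, s₂, 0]
  let e₃ : EuclideanSpace ℝ (Fin 3) := !₂[0, 0, s₃]
  have hnonneg : ∀ i (a b c : ℝ), a ^ 2 + b ^ 2 + c ^ 2 ≤ 1 →
      0 ≤ B.coord i ctr + a * (B.coord i).linear e₁ + b * (B.coord i).linear e₂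
        + c * (B.coord i).linear e₃ := by
    intro i a b c habc
    have hmem := hsub (ellipsoid_param_mem (d := d) hs₁ hs₂ hs₃ habc)
    have hmem' : (!₂[d + s₁ * a, s₂ * b, s₃ * c] : EuclideanSpace ℝ (Fin 3)) ∈
      convexHull ℝ (Set.range B) := hmem
    rw [B.convexHull_eq_nonneg_coord] at hmem'
    have hx : (!₂[d + s₁ * a, s₂ * b, s₃ * c] : EuclideanSpace ℝ (Fin 3)) =
        (a • e₁ + b • e₂ + c • e₃) +ᵥ ctr := by
      ext j
      fin_cases j <;> simp [e₁, e₂, e₃, ctr] <;> ring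
    have hi := hmem' i
    rw [hx, AffineMap.map_vadd] at hi
    simp only [map_add, map_smul, smul_eq_mul, vadd_eq_add] at hi
    linarith
  have hsum : ∀ x, ∑ i, B.coord i x = 1 := B.sum_coord_apply_eq_one
  have hvadd : ∀ i v, B.coord i (v + ctr) = (B.coord i).linear v + B.coord i ctr :=
    fun i v => (B.coord i).map_vadd ctr v
  have hlin0 : ∀ v, ∑ i, (B.coord i).linear v = 0 := by
    intro v
    have h1 := hsum (v + ctr)
    simp only [hvadd, Finset.sum_add_distrib] at h1
    linarith [hsum ctr]
  have hcomb : ∀ x, ∑ i, B.coord i x • p i = x := B.linear_combination_coord_eq_self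
  have hlin : ∀ v, ∑ i, (B.coord i).linear v • p i = v := by
    intro v
    have h1 := hcomb (v + ctr)
    simp only [hvadd, add_smul, Finset.sum_add_distrib] at h1
    rw [hcomb ctr] at h1
    exact add_right_cancel h1
  have hcoord : ∀ v (j : Fin 3), ∑ i, (B.coord i).linear v * p i j = v j := by
    intro v j
    conv_rhs => rw [← hlin v]
    simp
  have ha : ∀ i, 0 ≤ B.coord i ctr := by
    intro i
    simpa using hnonneg i 0 0 0 (by norm_num)
  refine sq_le_of_sum_cone_products (by positivity) (fun i => B.coord i ctr)
    (fun i => (B.coord i).linear e₁) (fun i => (B.coord i).linear e₂)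
    (fun i => (B.coord i).linear e₃) (fun i => p i 0) (fun i => p i 1) (fun i => p i 2)
    hR ha ?_ ?_ (hsum _) (hlin0 _) ?_ ?_ ?_
  · intro i
    set u := (B.coord i).linear e₁
    set v := (B.coord i).linear e₂
    set w := (B.coord i).linear e₃
    obtain ⟨n, hn0, hn⟩ : ∃ n : ℝ, 0 ≤ n ∧ n ^ 2 = u ^ 2 + v ^ 2 + w ^ 2 :=
      ⟨√(u ^ 2 + v ^ 2 + w ^ 2), Real.sqrt_nonneg _, Real.sq_sqrt (by positivity)⟩
    rw [← hn]
    rcases hn0.eq_or_lt with hn' | hn'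
    · rw [← hn']
      nlinarith [sq_nonneg (B.coord i ctr)]
    · have h1 := hnonneg i (-u / n) (-v / n) (-w / n) (by
        rw [div_pow, div_pow, div_pow, ← add_div, ← add_div, neg_sq, neg_sq, neg_sq, ← hn,
          div_self (by positivity)])
      have h2 : -u / n * u + -v / n * v + -w / n * w = -n := by
        field_simp
        linarith
      have h3 : n ≤ B.coord i ctr := by linarith
      gcongr
  · intro i
    have h1 := hp i
    rw [mem_sphere_zero_iff_norm] at h1
    have h2 := EuclideanSpace.real_norm_sq_eq (p i)
    rw [h1, Fin.sum_univ_three] at h2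
    exact h2.symm
  · have h1 := congrArg (fun x : EuclideanSpace ℝ (Fin 3) => x 0) (hcomb ctr)
    simpa [ctr] using h1
  · exact hcoord e₁ 0
  · rw [Finset.sum_add_distrib, hcoord e₂ 1, hcoord e₃ 2]
    simp [e₂, e₃]


/-- **Nested tetrahedron criterion for an axis-aligned ellipsoid whose first axis is
collinear with the centre vector.**
Let `s₁, s₂, s₃ > 0` and let `E` be the solid ellipsoid in `ℝ³` with semiaxes
`s₁, s₂, s₃` along the coordinate directions and centre `(d, 0, 0)` with `d ≥ 0`,
contained in the closed ball of radius `R > 0` about the origin.  Then a tetrahedron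
with all four vertices on the sphere of radius `R` contains `E` iff
`d² ≤ (R − s₁)² − (s₂ + s₃)²`. -/
theorem nested_tetrahedron_aligned_ellipsoid
    (s₁ s₂ s₃ d R : ℝ) (hs₁ : 0 < s₁) (hs₂ : 0 < s₂) (hs₃ : 0 < s₃)
    (hd : 0 ≤ d) (hR : 0 < R)
    (E : Set (EuclideanSpace ℝ (Fin 3)))
    (hE : E = {x | ((x 0 - d) / s₁) ^ 2 + (x 1 / s₂) ^ 2 + (x 2 / s₃) ^ 2 ≤ 1})
    (hEB : E ⊆ Metric.closedBall 0 R) :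
    (∃ p : Fin 4 → EuclideanSpace ℝ (Fin 3),
        (∀ i, p i ∈ Metric.sphere (0 : EuclideanSpace ℝ (Fin 3)) R) ∧
        E ⊆ convexHull ℝ (Set.range p)) ↔
      d ^ 2 ≤ (R - s₁) ^ 2 - (s₂ + s₃) ^ 2 := by
  subst hE
  constructor
  · rintro ⟨p, hp, hsub⟩
    exact sq_le_of_ellipsoid_subset_tetrahedron hs₁ hs₂ hs₃ hR.le p hp hsub
  · exact exists_tetrahedron_of_sq_le hs₁ hs₂ hs₃ hd (add_le_of_ellipsoid_subset_closedBall hs₁ hEB)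
end
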